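/- Under condition [A], the central limit theorem holds: (R(n) − an)/√n converges in distribution, as n → ∞, to the normal law N(0, σ²), where a := E[ζ]/E[τ] and σ² := E[(ζ − aτ)²]/E[τ]. -/

import Mathlib

noncomputable section

/-- A chain with unbounded variable length memory over the binary alphabet `{0,1}`,
with memory parameter `v ≥ 1`.  For `k ∈ ℕ ∪ {0}` (the distance from the current
position to the nearest `1`) and a word `w` of `v - 1` letters (the letters standing
to the left of that `1`), `p k w` is the probability of appending the character `1`.
The structure records the sample space, the appended characters `X n = r_n(n)`,
the full configuration `cfg`, the position `mpos ω n` of the rightmost `1` among the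
coordinates `≤ n`, and the Markov transition rule `htrans`. -/
structure VLMC (v : ℕ) (p : ℕ → (Fin (v - 1) → Bool) → ℝ) where
  /-- the sample space -/
  Ω : Type
  [mΩ : MeasurableSpace Ω]
  /-- the underlying probability measure -/
  P : MeasureTheory.Measure Ω
  hprob : MeasureTheory.IsProbabilityMeasure P
  hv : 0 < v
  /-- the (fixed) initial configuration; only the coordinates `i ≤ 0` are relevant -/
  r0 : ℤ → Bool
  /-- `X n` is the random character appended at step `n`, for `n ≥ 1` -/
  X : ℕ → Ω → Bool
  hXmeas : ∀ n, Measurable (X n)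
  /-- the full configuration (it does not change in time: at time `n` only the
  coordinates `≤ n` are relevant) -/
  cfg : Ω → ℤ → Bool
  hcfg : ∀ ω i, cfg ω i = if i ≤ 0 then r0 i else X i.toNat ω
  /-- `mpos ω n` is the position of the rightmost `1` among the coordinates `≤ n` -/
  mpos : Ω → ℕ → ℤ
  hmpos : ∀ ω n, mpos ω n ≤ (n : ℤ) ∧ cfg ω (mpos ω n) = true ∧
    ∀ i : ℤ, mpos ω n < i → i ≤ (n : ℤ) → cfg ω i = false
  /-- the transition rule: on any cylinder (in the appended characters) on which the
  distance from `n` to the nearest `1` equals `k` and the word of the `v - 1` letters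
  standing to the left of that `1` equals `w`, the conditional probability that the
  character appended at step `n + 1` equals `1` is `p k w`. -/
  htrans : ∀ (n : ℕ) (b : Fin n → Bool) (k : ℕ) (w : Fin (v - 1) → Bool),
    (∀ ω, (∀ i : Fin n, X (i.1 + 1) ω = b i) →
      ((n : ℤ) - mpos ω n = (k : ℤ) ∧
        ∀ j : Fin (v - 1), cfg ω (mpos ω n - ((v : ℤ) - 1) + (j.1 : ℤ)) = w j)) →
    P {ω | (∀ i : Fin n, X (i.1 + 1) ω = b i) ∧ X (n + 1) ω = true}
      = ENNReal.ofReal (p k w) * P {ω | ∀ i : Fin n, X (i.1 + 1) ω = b i}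

open MeasureTheory Filter

namespace VLMC

variable {v : ℕ} {p : ℕ → (Fin (v - 1) → Bool) → ℝ}

/-- Condition [A]: the initial configuration contains at least one `1`, and all the
transition probabilities lie between `δ2` and `δ1`, where `0 < δ2 < δ1 < 1`. -/
def CondA (S : VLMC v p) (δ1 δ2 : ℝ) : Prop :=
  (∃ i : ℤ, i ≤ 0 ∧ S.r0 i = true) ∧
  0 < δ2 ∧ δ2 < δ1 ∧ δ1 < 1 ∧
  ∀ (k : ℕ) (w : Fin (v - 1) → Bool), δ2 ≤ p k w ∧ p k w ≤ δ1

/-- `R n`, the number of `1`s appended during the first `n` steps -/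
def R (S : VLMC v p) (n : ℕ) (ω : S.Ω) : ℕ :=
  ∑ k ∈ Finset.Icc 1 n, (S.X k ω).toNat

/-- `Y(n) = y₀ = (0,(0,…,0,1))`, i.e. the character at position `n` is `1` and the
`v - 1` letters to its left are all `0` -/
def hitY0 (S : VLMC v p) (ω : S.Ω) (n : ℕ) : Prop :=
  S.mpos ω n = (n : ℤ) ∧
    ∀ j : Fin (v - 1), S.cfg ω ((n : ℤ) - ((v : ℤ) - 1) + (j.1 : ℤ)) = false

/-- `T k`, the time of the `k`-th visit of the chain `Y` to the state `y₀`
(`T 0 = 0`) -/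
def T (S : VLMC v p) : ℕ → S.Ω → ℕ
  | 0, _ => 0
  | k + 1, ω => sInf {n | T S k ω < n ∧ S.hitY0 ω n}

/-- `τ_k = T_k - T_{k-1}`, the spacings between consecutive visits to `y₀` -/
def tau (S : VLMC v p) (k : ℕ) (ω : S.Ω) : ℕ := S.T k ω - S.T (k - 1) ω

/-- `ζ_k`, the number of `1`s appended at the times `n ∈ (T_{k-1}, T_k]` -/
def zeta (S : VLMC v p) (k : ℕ) (ω : S.Ω) : ℕ :=
  ∑ n ∈ Finset.Ioc (S.T (k - 1) ω) (S.T k ω), (S.X n ω).toNat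

/-- `ν(n) = max {k ≥ 0 : T_k < n}` -/
def nu (S : VLMC v p) (n : ℕ) (ω : S.Ω) : ℕ := sSup {k | S.T k ω < n}

/-- the generalized renewal process `Z(n) = Σ_{k=0}^{ν(n)} ζ_k` (with `ζ_0 = 0`) -/
def Z (S : VLMC v p) (n : ℕ) (ω : S.Ω) : ℕ :=
  ∑ k ∈ Finset.range (S.nu n ω + 1), S.zeta k ω

/-- `a = E ζ / E τ`, where `(τ, ζ) = (τ_2, ζ_2)` has the common distribution of the
regeneration vectors `ξ_k = (τ_k, ζ_k)`, `k ≥ 2` -/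
def a (S : VLMC v p) : ℝ :=
  (∫ ω, (S.zeta 2 ω : ℝ) ∂S.P) / (∫ ω, (S.tau 2 ω : ℝ) ∂S.P)

/-- `σ² = E (ζ - aτ)² / E τ` -/
def sigma2 (S : VLMC v p) : ℝ :=
  (∫ ω, ((S.zeta 2 ω : ℝ) - S.a * (S.tau 2 ω : ℝ)) ^ 2 ∂S.P) /
    (∫ ω, (S.tau 2 ω : ℝ) ∂S.P)

/-- `ψ(λ,μ) = E e^{λτ + μζ}` (as an extended nonnegative real number) -/
def psi (S : VLMC v p) (l m : ℝ) : ENNReal :=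
  ∫⁻ ω, ENNReal.ofReal (Real.exp (l * S.tau 2 ω + m * S.zeta 2 ω)) ∂S.P

/-- `ψ₁(λ,μ) = E e^{λτ₁ + μζ₁}` -/
def psi1 (S : VLMC v p) (l m : ℝ) : ℝ :=
  ∫ ω, Real.exp (l * S.tau 1 ω + m * S.zeta 1 ω) ∂S.P

/-- the deviation function `D(θ,α) = sup {λθ + μα : A(λ,μ) ≤ 0}` where `A = ln ψ`,
so that `A(λ,μ) ≤ 0 ↔ ψ(λ,μ) ≤ 1` -/
def D2 (S : VLMC v p) (θ α : ℝ) : ℝ :=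
  sSup {x | ∃ l m : ℝ, S.psi l m ≤ 1 ∧ x = l * θ + m * α}

/-- `D(α) = D(1,α)` -/
def D (S : VLMC v p) (α : ℝ) : ℝ := S.D2 1 α

/-- the chain starts from the state `y₀ = (0,(0,…,0,1))`, i.e. `Y(0) = y₀`: the
initial configuration has a `1` at position `0` preceded by `v - 1` zeros -/
def StartsAtY0 (S : VLMC v p) : Prop :=
  S.r0 0 = true ∧ ∀ i : ℤ, 1 - (v : ℤ) ≤ i → i < 0 → S.r0 i = false

end VLMC

section RenewalReward

open MeasureTheory ProbabilityTheory Filter Topology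

variable {Ω : Type*} [MeasurableSpace Ω] {P : Measure Ω} [IsProbabilityMeasure P]

/-- **Kolmogorov's maximal inequality** for sums of independent centered random variables. -/
theorem sq_mul_measureReal_exists_abs_sum_ge_le {X : ℕ → Ω → ℝ} (hX : ∀ i, Measurable (X i))
    (hL2 : ∀ i, MemLp (X i) 2 P) (hmean : ∀ i, ∫ ω, X i ω ∂P = 0) (hind : iIndepFun X P)
    {ε : ℝ} (hε : 0 < ε) (n : ℕ) :
    ε ^ 2 * P.real {ω | ∃ k ≤ n, ε ≤ |∑ i ∈ Finset.range k, X i ω|} ≤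
      ∑ i ∈ Finset.range n, ∫ ω, X i ω ^ 2 ∂P := by
  classical
  set B : ℕ → Set Ω := fun n => {ω | ∃ k ≤ n, ε ≤ |∑ i ∈ Finset.range k, X i ω|} with hB
  have hBm : ∀ n, MeasurableSet (B n) := by
    intro n
    have : B n = ⋃ k ∈ Finset.range (n + 1), {ω | ε ≤ |∑ i ∈ Finset.range k, X i ω|} := by
      ext ω; simp [hB]
    rw [this]
    refine Finset.measurableSet_biUnion _ fun k _ => ?_
    exact measurableSet_le measurable_const
      ((Finset.measurable_fun_sum _ fun i _ => hX i).abs)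
  have hlt : ∀ n ω, ω ∉ B n → |∑ i ∈ Finset.range n, X i ω| < ε := by
    intro n ω h
    by_contra hc
    exact h ⟨n, le_rfl, not_lt.1 hc⟩
  set Φ : ℕ → Ω → ℝ :=
    fun n ω => if ω ∈ B n then ε ^ 2 else (∑ i ∈ Finset.range n, X i ω) ^ 2 with hΦ
  set V : ℕ → Ω → ℝ :=
    fun n ω => if ω ∈ B n then 0 else ∑ i ∈ Finset.range n, X i ω with hV
  have hΦint : ∀ n, Integrable (Φ n) P := by
    intro n
    refine Integrable.of_bound (Measurable.aestronglyMeasurable ?_) (ε ^ 2) (ae_of_all _ ?_)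
    · exact Measurable.ite (hBm n) measurable_const
        ((Finset.measurable_fun_sum _ fun i _ => hX i).pow_const 2)
    · intro ω
      simp only [hΦ]
      split_ifs with h
      · rw [Real.norm_of_nonneg (by positivity)]
      · rw [Real.norm_of_nonneg (by positivity), ← sq_abs]
        exact pow_le_pow_left₀ (abs_nonneg _) (hlt n ω h).le 2
  have hVm : ∀ n, Measurable (V n) := fun n =>
    Measurable.ite (hBm n) measurable_const (Finset.measurable_fun_sum _ fun i _ => hX i)
  have hVbd : ∀ n ω, ‖V n ω‖ ≤ ε := by
    intro n ω
    simp only [hV]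
    split_ifs with h
    · simpa using hε.le
    · exact (hlt n ω h).le
  have hindV : ∀ n, IndepFun (V n) (X n) P := by
    intro n
    have h1 := hind.indepFun_finset (Finset.range n) {n} (by simp) hX
    let ext : ((Finset.range n) → ℝ) → ℕ → ℝ :=
      fun y i => if h : i ∈ Finset.range n then y ⟨i, h⟩ else 0
    have hext : ∀ i, Measurable fun y => ext y i := by
      intro i
      by_cases h : i ∈ Finset.range n
      · simp only [ext, dif_pos h]; exact measurable_pi_apply _
      · simp only [ext, dif_neg h]; exact measurable_const
    let φ : ((Finset.range n) → ℝ) → ℝ := fun y =>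
      if ∃ k ≤ n, ε ≤ |∑ i ∈ Finset.range k, ext y i| then 0 else ∑ i ∈ Finset.range n, ext y i
    have hφ : Measurable φ := by
      refine Measurable.ite ?_ measurable_const (Finset.measurable_fun_sum _ fun i _ => hext i)
      have : {y | ∃ k ≤ n, ε ≤ |∑ i ∈ Finset.range k, ext y i|} =
          ⋃ k ∈ Finset.range (n + 1), {y | ε ≤ |∑ i ∈ Finset.range k, ext y i|} := by
        ext ω; simp
      rw [this]
      refine Finset.measurableSet_biUnion _ fun k _ => ?_
      exact measurableSet_le measurable_const
        ((Finset.measurable_fun_sum _ fun i _ => hext i).abs)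
    have h2 := h1.comp hφ (measurable_pi_apply (⟨n, by simp⟩ : ({n} : Finset ℕ)))
    have hVφ : ∀ ω, V n ω = φ (fun i => X i.1 ω) := by
      intro ω
      have hsum : ∀ k ≤ n, ∑ i ∈ Finset.range k, ext (fun i => X i.1 ω) i =
          ∑ i ∈ Finset.range k, X i ω := by
        intro k hk
        refine Finset.sum_congr rfl fun i hi => ?_
        have : i ∈ Finset.range n := Finset.mem_range.2 ((Finset.mem_range.1 hi).trans_le hk)
        simp only [ext, dif_pos this]
      have hiff : (∃ k ≤ n, ε ≤ |∑ i ∈ Finset.range k, ext (fun i => X i.1 ω) i|) ↔ ω ∈ B n := by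
        refine exists_congr fun k => and_congr_right fun hk => ?_
        rw [hsum k hk]
      simp only [hV, φ]
      by_cases h : ω ∈ B n
      · rw [if_pos h, if_pos (hiff.2 h)]
      · rw [if_neg h, if_neg (mt hiff.1 h), hsum n le_rfl]
    have hcomp : V n = φ ∘ fun ω i => X i.1 ω := by
      funext ω
      exact hVφ ω
    rw [hcomp]
    exact h2
  have hXint : ∀ i, Integrable (X i) P := fun i => (hL2 i).integrable one_le_two
  have hVX : ∀ n, Integrable (fun ω => V n ω * X n ω) P := fun n =>
    (hXint n).bdd_mul (hVm n).aestronglyMeasurable (ae_of_all _ (hVbd n))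
  have hstep : ∀ n, ∫ ω, Φ (n + 1) ω ∂P ≤ ∫ ω, Φ n ω ∂P + ∫ ω, X n ω ^ 2 ∂P := by
    intro n
    have hzero : ∫ ω, V n ω * X n ω ∂P = 0 := by
      rw [(hindV n).integral_fun_mul_eq_mul_integral (hVm n).aestronglyMeasurable
        (hX n).aestronglyMeasurable, hmean n, mul_zero]
    have hle : ∀ ω, Φ (n + 1) ω ≤ Φ n ω + 2 * (V n ω * X n ω) + X n ω ^ 2 := by
      intro ω
      by_cases h : ω ∈ B n
      · have h' : ω ∈ B (n + 1) := by
          obtain ⟨k, hk, hk'⟩ := h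
          exact ⟨k, hk.trans (Nat.le_succ n), hk'⟩
        simp only [hΦ, hV, if_pos h, if_pos h']
        nlinarith [sq_nonneg (X n ω)]
      · have heq : (∑ i ∈ Finset.range n, X i ω) ^ 2 +
            2 * ((∑ i ∈ Finset.range n, X i ω) * X n ω) + X n ω ^ 2 =
            (∑ i ∈ Finset.range (n + 1), X i ω) ^ 2 := by
          rw [Finset.sum_range_succ]; ring
        simp only [hΦ, hV, if_neg h]
        rw [heq]
        split_ifs with h'
        · obtain ⟨k, hk, hk'⟩ := h'
          have : k = n + 1 := by
            by_contra hne
            exact h ⟨k, by omega, hk'⟩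
          subst this
          rw [← sq_abs (∑ i ∈ Finset.range (n + 1), X i ω)]
          exact pow_le_pow_left₀ hε.le hk' 2
        · exact le_rfl
    have hsq : Integrable (fun ω => X n ω ^ 2) P := (hL2 n).integrable_sq
    have hadd : Integrable (fun ω => Φ n ω + 2 * (V n ω * X n ω)) P :=
      (hΦint n).add ((hVX n).const_mul 2)
    calc ∫ ω, Φ (n + 1) ω ∂P ≤ ∫ ω, (Φ n ω + 2 * (V n ω * X n ω) + X n ω ^ 2) ∂P :=
          integral_mono (hΦint _) (hadd.add hsq) hle
      _ = ∫ ω, Φ n ω ∂P + ∫ ω, X n ω ^ 2 ∂P := by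
          rw [integral_add hadd hsq,
            integral_add (hΦint n) ((hVX n).const_mul 2), integral_const_mul, hzero]
          ring
  have hbound : ∀ n, ∫ ω, Φ n ω ∂P ≤ ∑ i ∈ Finset.range n, ∫ ω, X i ω ^ 2 ∂P := by
    intro n
    induction n with
    | zero =>
      have : Φ 0 = fun _ => 0 := by
        funext ω
        have : ω ∉ B 0 := by
          rintro ⟨k, hk, hk'⟩
          obtain rfl : k = 0 := by omega
          simp at hk'
          linarith
        simp [hΦ, this]
      simp [this]
    | succ n ih =>
      rw [Finset.sum_range_succ]
      linarith [hstep n]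
  refine le_trans ?_ (hbound n)
  have : ε ^ 2 * P.real (B n) = ∫ ω, (B n).indicator (fun _ => ε ^ 2) ω ∂P := by
    rw [integral_indicator_const _ (hBm n), smul_eq_mul, mul_comm]
  rw [this]
  refine integral_mono ((integrable_const _).indicator (hBm n)) (hΦint n) fun ω => ?_
  by_cases h : ω ∈ B n
  · simp [hΦ, h]
  · simp only [hΦ, Set.indicator_of_notMem h, if_neg h]
    positivity


/-- A sequence growing like `μ * m` straddles `n` between the indices `α n` and `β n` as soon as
`α < 1 / μ < β`. -/
theorem eventually_floor_le_and_lt_ceil {V : ℕ → ℝ} {μ α β : ℝ}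
    (hV : Tendsto (fun m : ℕ => V m / m) atTop (𝓝 μ)) (hα : 0 < α) (hβ : 0 < β)
    (hαμ : μ * α < 1) (hβμ : 1 < μ * β) :
    ∀ᶠ n : ℕ in atTop, V ⌊α * n⌋₊ ≤ n ∧ (n : ℝ) < V ⌈β * n⌉₊ := by
  have hcast : Tendsto (fun n : ℕ => (n : ℝ)) atTop atTop := tendsto_natCast_atTop_atTop
  have hfl : Tendsto (fun n : ℕ => ⌊α * n⌋₊) atTop atTop :=
    tendsto_nat_floor_atTop.comp (hcast.const_mul_atTop hα)
  have hce : Tendsto (fun n : ℕ => ⌈β * n⌉₊) atTop atTop :=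
    tendsto_nat_ceil_atTop.comp (hcast.const_mul_atTop hβ)
  have h1 : Tendsto (fun n : ℕ => V ⌊α * n⌋₊ / (⌊α * n⌋₊ : ℝ) * ((⌊α * n⌋₊ : ℝ) / n)) atTop
      (𝓝 (μ * α)) :=
    (hV.comp hfl).mul ((tendsto_nat_floor_mul_div_atTop hα.le).comp hcast)
  have h2 : Tendsto (fun n : ℕ => V ⌈β * n⌉₊ / (⌈β * n⌉₊ : ℝ) * ((⌈β * n⌉₊ : ℝ) / n)) atTop
      (𝓝 (μ * β)) :=
    (hV.comp hce).mul ((tendsto_nat_ceil_mul_div_atTop hβ.le).comp hcast)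
  filter_upwards [h1.eventually_lt_const hαμ, h2.eventually_const_lt hβμ,
    hfl.eventually_gt_atTop 0, hce.eventually_gt_atTop 0, eventually_gt_atTop 0]
    with n h1 h2 hf hc hn
  have hn' : (0 : ℝ) < n := by exact_mod_cast hn
  have hf' : (0 : ℝ) < ⌊α * n⌋₊ := by exact_mod_cast hf
  have hc' : (0 : ℝ) < ⌈β * n⌉₊ := by exact_mod_cast hc
  rw [div_mul_div_cancel₀ hf'.ne', div_lt_one hn'] at h1
  rw [div_mul_div_cancel₀ hc'.ne', one_lt_div hn'] at h2
  exact ⟨h1.le, h2⟩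

theorem exists_le_and_lt_succ {V : ℕ → ℝ} {x : ℝ} {M K : ℕ} (hM : V M ≤ x) (hK : x < V K)
    (hMK : M ≤ K) : ∃ m, M ≤ m ∧ m < K ∧ V m ≤ x ∧ x < V (m + 1) := by
  induction K, hMK using Nat.le_induction with
  | base => exact absurd hM (not_le.2 hK)
  | succ K hMK ih =>
    by_cases h : x < V K
    · obtain ⟨m, h1, h2, h3⟩ := ih h
      exact ⟨m, h1, h2.trans (Nat.lt_succ_self K), h3⟩
    · exact ⟨K, hMK, Nat.lt_succ_self K, not_lt.1 h, hK⟩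

/-- The first `O(n)` terms of an identically distributed sequence with a finite fourth moment are
all `o(√n)` in probability. -/
theorem tendsto_measureReal_exists_sqrt_le {τ : ℕ → Ω → ℝ} (hτ0 : ∀ i ω, 0 ≤ τ i ω)
    (hτ4 : Integrable (fun ω => τ 0 ω ^ 4) P) (hτid : ∀ i, IdentDistrib (τ i) (τ 0) P P)
    {β ε : ℝ} (hβ : 0 < β) (hε : 0 < ε) :
    Tendsto (fun n : ℕ => P.real {ω | ∃ m < ⌈β * n⌉₊, ε * √n ≤ τ m ω}) atTop (𝓝 0) := by
  set E := ∫ ω, τ 0 ω ^ 4 ∂P with hE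
  have hbound : ∀ n : ℕ, 0 < n → P.real {ω | ∃ m < ⌈β * n⌉₊, ε * √n ≤ τ m ω} ≤
      ((⌈β * n⌉₊ : ℝ) / n) * (E / ε ^ 4) * (1 / (n : ℝ)) := by
    intro n hn
    have hn' : (0 : ℝ) < n := by exact_mod_cast hn
    have hone : ∀ m, P.real {ω | ε * √n ≤ τ m ω} ≤ E / (ε ^ 4 * (n : ℝ) ^ 2) := by
      intro m
      have h1 : P.real {ω | ε * √n ≤ τ m ω} = P.real {ω | ε * √n ≤ τ 0 ω} := by
        simp only [measureReal_def]
        congr 1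
        exact (hτid m).measure_mem_eq measurableSet_Ici
      have h2 := mul_meas_ge_le_integral_of_nonneg (μ := P) (f := fun ω => τ 0 ω ^ 4)
        (ae_of_all _ fun ω => by have := hτ0 0 ω; positivity) hτ4 (ε ^ 4 * (n : ℝ) ^ 2)
      rw [h1, le_div_iff₀ (by positivity), mul_comm]
      refine le_trans (mul_le_mul_of_nonneg_left (measureReal_mono fun ω hω => ?_)
        (by positivity)) h2
      have h3 : ε ^ 4 * (n : ℝ) ^ 2 = (ε * √n) ^ 4 := by
        have : √(n : ℝ) ^ 4 = (n : ℝ) ^ 2 := by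
          rw [show 4 = 2 * 2 by norm_num, pow_mul, Real.sq_sqrt hn'.le]
        rw [mul_pow, this]
      simp only [Set.mem_ofPred_eq] at hω ⊢
      rw [h3]
      exact pow_le_pow_left₀ (by positivity) hω 4
    have hU : {ω | ∃ m < ⌈β * n⌉₊, ε * √n ≤ τ m ω} =
        ⋃ m ∈ Finset.range ⌈β * n⌉₊, {ω | ε * √n ≤ τ m ω} := by
      ext ω; simp
    rw [hU]
    refine (measureReal_biUnion_finset_le _ _).trans ?_
    refine (Finset.sum_le_sum fun m _ => hone m).trans (le_of_eq ?_)
    rw [Finset.sum_const, Finset.card_range, nsmul_eq_mul]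
    field_simp
  have hlim : Tendsto (fun n : ℕ => ((⌈β * n⌉₊ : ℝ) / n) * (E / ε ^ 4) * (1 / (n : ℝ))) atTop
      (𝓝 (β * (E / ε ^ 4) * 0)) :=
    (((tendsto_nat_ceil_mul_div_atTop hβ.le).comp tendsto_natCast_atTop_atTop).mul_const _).mul
      tendsto_one_div_atTop_nhds_zero_nat
  rw [mul_zero] at hlim
  refine squeeze_zero' (Eventually.of_forall fun n => measureReal_nonneg) ?_ hlim
  filter_upwards [eventually_gt_atTop 0] with n hn using hbound n hn

/-- Over a window of relative width `β - α`, the partial sums of centered i.i.d. variables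
oscillate by at most `ε √n`, with a probability controlled by Kolmogorov's inequality. -/
theorem measureReal_exists_window_sum_ge_le {W : ℕ → Ω → ℝ} (hWm : ∀ i, Measurable (W i))
    (hWL2 : MemLp (W 0) 2 P) (hW0 : ∫ ω, W 0 ω ∂P = 0) (hWind : iIndepFun W P)
    (hWid : ∀ i, IdentDistrib (W i) (W 0) P P) (M L : ℕ) {r : ℝ} (hr : 0 < r) :
    r ^ 2 * P.real {ω | ∃ k ≤ L, r ≤ |∑ i ∈ Finset.range k, W (M + i) ω|} ≤
      L * ∫ ω, W 0 ω ^ 2 ∂P := by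
  have h := sq_mul_measureReal_exists_abs_sum_ge_le (P := P) (X := fun i => W (M + i))
    (fun i => hWm _) (fun i => (hWid _).symm.memLp_snd hWL2)
    (fun i => (hWid _).integral_eq.trans hW0) (hWind.precomp (add_right_injective M)) hr L
  refine h.trans (le_of_eq ?_)
  have : ∀ i, ∫ ω, W (M + i) ω ^ 2 ∂P = ∫ ω, W 0 ω ^ 2 ∂P := fun i =>
    ((hWid (M + i)).comp (measurable_id.pow_const 2)).integral_eq
  simp [this]

section

variable {τ W G : ℕ → Ω → ℝ} {T₁ G₁ : Ω → ℝ} {C : ℝ}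

/-- **Anscombe-type approximation**: a process `G` which follows the random walk with steps `W`
along the renewal times with spacings `τ` is, up to `o(√n)` in probability, the random walk
stopped at the deterministic index `n / E τ`. -/
theorem tendstoInMeasure_sub_sum_div_sqrt (hτm : ∀ i, Measurable (τ i)) (hτ0 : ∀ i ω, 0 ≤ τ i ω)
    (hτint : Integrable (τ 0) P) (hτ4 : Integrable (fun ω => τ 0 ω ^ 4) P)
    (hτind : iIndepFun τ P) (hτid : ∀ i, IdentDistrib (τ i) (τ 0) P P)
    (hμ : 0 < ∫ ω, τ 0 ω ∂P) (hWm : ∀ i, Measurable (W i)) (hWL2 : MemLp (W 0) 2 P)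
    (hW0 : ∫ ω, W 0 ω ∂P = 0) (hWind : iIndepFun W P)
    (hWid : ∀ i, IdentDistrib (W i) (W 0) P P) (hT₁ : Measurable T₁) (hG₁ : Measurable G₁)
    (hC : 0 < C)
    (hG : ∀ᵐ ω ∂P, ∀ n m : ℕ, T₁ ω + ∑ i ∈ Finset.range m, τ i ω ≤ n →
      (n : ℝ) < T₁ ω + ∑ i ∈ Finset.range (m + 1), τ i ω →
      |G n ω - (G₁ ω + ∑ i ∈ Finset.range m, W i ω)| ≤ C * τ m ω) :
    TendstoInMeasure P (fun (n : ℕ) ω => (G n ω -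
      ∑ i ∈ Finset.range ⌊(∫ ω, τ 0 ω ∂P)⁻¹ * n⌋₊, W i ω) / √n) atTop 0 := by
  set μ := ∫ ω, τ 0 ω ∂P with hμdef
  set σ := ∫ ω, W 0 ω ^ 2 ∂P with hσ
  have hσ0 : 0 ≤ σ := integral_nonneg fun ω => sq_nonneg _
  set V : ℕ → Ω → ℝ := fun m ω => T₁ ω + ∑ i ∈ Finset.range m, τ i ω with hVdef
  have hVm : ∀ m, Measurable (V m) := fun m =>
    hT₁.add (Finset.measurable_fun_sum _ fun i _ => hτm i)
  have hVlim : ∀ᵐ ω ∂P, Tendsto (fun m : ℕ => V m ω / m) atTop (𝓝 μ) := by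
    filter_upwards [strong_law_ae_real τ hτint (fun i j hij => hτind.indepFun hij) hτid] with ω hω
    have h1 : Tendsto (fun m : ℕ => T₁ ω / (m : ℝ)) atTop (𝓝 0) :=
      tendsto_const_div_atTop_nhds_zero_nat _
    have h2 := h1.add hω
    rw [zero_add] at h2
    refine h2.congr fun m => ?_
    simp only [hVdef, add_div]
  rw [tendstoInMeasure_iff_measureReal_norm]
  intro ε hε
  simp only [Pi.zero_apply, sub_zero]
  set r := ε / 5 with hr
  have hr0 : 0 < r := by positivity
  rw [Metric.tendsto_nhds]
  intro κ hκ
  -- the relative half-width of the window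
  obtain ⟨η, hη0, hημ, hησ⟩ : ∃ η : ℝ, 0 < η ∧ η < μ⁻¹ ∧ 2 * η * σ / r ^ 2 < κ / 4 := by
    have h1 : Tendsto (fun η : ℝ => 2 * η * σ / r ^ 2) (𝓝[>] 0) (𝓝 (2 * 0 * σ / r ^ 2)) :=
      (Continuous.tendsto (by fun_prop) 0).mono_left nhdsWithin_le_nhds
    have h2 : ∀ᶠ η : ℝ in 𝓝[>] 0, η < μ⁻¹ :=
      nhdsWithin_le_nhds (Iio_mem_nhds (by positivity))
    have h3 := h1.eventually_lt_const (u := κ / 4) (by simp; positivity)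
    obtain ⟨η, ha, hb, hc⟩ := (h2.and (h3.and self_mem_nhdsWithin)).exists
    exact ⟨η, hc, ha, hb⟩
  set α := μ⁻¹ - η with hα
  set β := μ⁻¹ + η with hβ
  have hα0 : 0 < α := by rw [hα]; linarith
  have hβ0 : 0 < β := by rw [hβ]; positivity
  have hαμ : μ * α < 1 := by
    rw [hα, mul_sub, mul_inv_cancel₀ hμ.ne']; nlinarith
  have hβμ : 1 < μ * β := by
    rw [hβ, mul_add, mul_inv_cancel₀ hμ.ne']; nlinarith
  set A : ℕ → Set Ω := fun n => {ω | ¬ ((V ⌊α * n⌋₊ ω ≤ n ∧ (n : ℝ) < V ⌈β * n⌉₊ ω) ∧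
    |G₁ ω| < r * √n)} with hA
  have hAlim : Tendsto (fun n => P.real (A n)) atTop (𝓝 0) := by
    have h := tendsto_measure_of_ae_tendsto_indicator_of_isFiniteMeasure (μ := P) (A := ∅)
      (As := A) atTop MeasurableSet.empty
      (fun n => (((measurableSet_le (hVm _) measurable_const).inter
        (measurableSet_lt measurable_const (hVm _))).inter
        (measurableSet_lt hG₁.abs measurable_const)).compl) ?_
    · rw [measure_empty] at h
      exact (ENNReal.tendsto_toReal ENNReal.zero_ne_top).comp h
    · filter_upwards [hVlim] with ω hω
      have hsq : Tendsto (fun n : ℕ => r * √n) atTop atTop :=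
        (Real.tendsto_sqrt_atTop.comp tendsto_natCast_atTop_atTop).const_mul_atTop hr0
      filter_upwards [eventually_floor_le_and_lt_ceil hω hα0 hβ0 hαμ hβμ,
        hsq.eventually_gt_atTop |G₁ ω|] with n h1 h2
      simp only [hA, Set.mem_ofPred_eq, Set.mem_empty_iff_false, iff_false, not_not]
      exact ⟨h1, h2⟩
  have hBlim := tendsto_measureReal_exists_sqrt_le (P := P) hτ0 hτ4 hτid hβ0
    (div_pos hr0 hC)
  have hDlim : Tendsto (fun n : ℕ => ((⌈β * n⌉₊ : ℝ) / n - (⌊α * n⌋₊ : ℝ) / n) * σ / r ^ 2)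
      atTop (𝓝 ((β - α) * σ / r ^ 2)) :=
    ((((tendsto_nat_ceil_mul_div_atTop hβ0.le).comp tendsto_natCast_atTop_atTop).sub
      ((tendsto_nat_floor_mul_div_atTop hα0.le).comp tendsto_natCast_atTop_atTop)).mul_const
        _).div_const _
  have hDκ : (β - α) * σ / r ^ 2 < κ / 4 := by
    rwa [show β - α = 2 * η by rw [hα, hβ]; ring]
  filter_upwards [hAlim.eventually_lt_const (show 0 < κ / 4 by positivity),
    hBlim.eventually_lt_const (show 0 < κ / 4 by positivity),
    hDlim.eventually_lt_const hDκ, eventually_gt_atTop 0] with n hAn hBn hDn hn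
  have hn' : (0 : ℝ) < n := by exact_mod_cast hn
  have hsq : 0 < √(n : ℝ) := Real.sqrt_pos.2 hn'
  set M := ⌊α * n⌋₊ with hM
  set K := ⌈β * n⌉₊ with hK
  set N := ⌊μ⁻¹ * n⌋₊ with hN
  have hMN : M ≤ N := Nat.floor_le_floor (by rw [hα]; nlinarith)
  have hNK : N ≤ K := by
    have h1 : N ≤ ⌊β * n⌋₊ := Nat.floor_le_floor (by rw [hβ]; nlinarith)
    exact h1.trans (Nat.floor_le_ceil _)
  set D : Set Ω := {ω | ∃ k ≤ K - M, r * √n ≤ |∑ i ∈ Finset.range k, W (M + i) ω|} with hD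
  have hDn' : P.real D < κ / 4 := by
    have h := measureReal_exists_window_sum_ge_le (P := P) hWm hWL2 hW0 hWind hWid M (K - M)
      (mul_pos hr0 hsq)
    rw [mul_pow, Real.sq_sqrt hn'.le, Nat.cast_sub (hMN.trans hNK)] at h
    refine lt_of_le_of_lt ?_ hDn
    rw [le_div_iff₀ (by positivity), ← sub_div, div_mul_eq_mul_div, le_div_iff₀ hn']
    linarith
  have hsub : ∀ᵐ ω ∂P, ω ∈ {ω | ε ≤ ‖(G n ω - ∑ i ∈ Finset.range N, W i ω) / √n‖} →
      ω ∈ A n ∪ ({ω | ∃ m < K, r / C * √n ≤ τ m ω} ∪ D) := by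
    filter_upwards [hG] with ω hω hmem
    by_contra hnot
    simp only [Set.mem_union, not_or] at hnot
    obtain ⟨h1, h2, h3⟩ := hnot
    simp only [hA, Set.mem_ofPred_eq, not_not] at h1
    obtain ⟨⟨hVM, hVK⟩, hG1⟩ := h1
    obtain ⟨m, hMm, hmK, hm1, hm2⟩ :=
      exists_le_and_lt_succ (V := fun m => V m ω) hVM hVK (hMN.trans hNK)
    have h4 := hω n m hm1 hm2
    have h5 : τ m ω < r / C * √n := by
      by_contra hc
      exact h2 ⟨m, hmK, not_lt.1 hc⟩
    have h6 : C * τ m ω < r * √n := by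
      calc C * τ m ω < C * (r / C * √n) := mul_lt_mul_of_pos_left h5 hC
        _ = r * √n := by field_simp
    have hwin : ∀ j, M ≤ j → j ≤ K →
        |∑ i ∈ Finset.range j, W i ω - ∑ i ∈ Finset.range M, W i ω| < r * √n := by
      intro j hj hjK
      by_contra hc
      refine h3 ⟨j - M, by omega, ?_⟩
      have : ∑ i ∈ Finset.range j, W i ω - ∑ i ∈ Finset.range M, W i ω =
          ∑ i ∈ Finset.range (j - M), W (M + i) ω := by
        obtain ⟨d, rfl⟩ := Nat.exists_eq_add_of_le hj
        rw [Finset.sum_range_add, Nat.add_sub_cancel_left, add_sub_cancel_left]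
      rw [← this]
      exact not_lt.1 hc
    have h7 := hwin m hMm hmK.le
    have h8 := hwin N hMN hNK
    rw [Real.norm_eq_abs, abs_div, abs_of_pos hsq, le_div_iff₀ hsq] at hmem
    have h9 : ε * √n = 5 * (r * √n) := by rw [hr]; ring
    rw [h9] at hmem
    have h10 : 0 < r * √n := mul_pos hr0 hsq
    rw [abs_lt] at h7 h8 hG1
    rw [abs_le] at h4
    rcases le_abs.1 hmem with h | h <;> linarith [h4.1, h4.2, h7.1, h7.2, h8.1, h8.2, hG1.1, hG1.2]
  have hle : P.real {ω | ε ≤ ‖(G n ω - ∑ i ∈ Finset.range N, W i ω) / √n‖} ≤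
      P.real (A n) + (P.real {ω | ∃ m < K, r / C * √n ≤ τ m ω} + P.real D) := by
    refine le_trans ?_ ((measureReal_union_le _ _).trans
      (add_le_add_right (measureReal_union_le _ _) _))
    exact ENNReal.toReal_mono (measure_ne_top _ _) (measure_mono_ae hsub)
  rw [dist_zero_right, Real.norm_of_nonneg measureReal_nonneg]
  linarith

/-- **Central limit theorem for renewal-reward processes.** -/
theorem tendstoInDistribution_renewalReward_div_sqrt (hτm : ∀ i, Measurable (τ i))
    (hτ0 : ∀ i ω, 0 ≤ τ i ω)
    (hτint : Integrable (τ 0) P) (hτ4 : Integrable (fun ω => τ 0 ω ^ 4) P)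
    (hτind : iIndepFun τ P) (hτid : ∀ i, IdentDistrib (τ i) (τ 0) P P)
    (hμ : 0 < ∫ ω, τ 0 ω ∂P) (hWm : ∀ i, Measurable (W i)) (hWL2 : MemLp (W 0) 2 P)
    (hW0 : ∫ ω, W 0 ω ∂P = 0) (hWind : iIndepFun W P)
    (hWid : ∀ i, IdentDistrib (W i) (W 0) P P) (hT₁ : Measurable T₁) (hG₁ : Measurable G₁)
    (hC : 0 < C) (hGm : ∀ n, Measurable (G n))
    (hG : ∀ᵐ ω ∂P, ∀ n m : ℕ, T₁ ω + ∑ i ∈ Finset.range m, τ i ω ≤ n →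
      (n : ℝ) < T₁ ω + ∑ i ∈ Finset.range (m + 1), τ i ω →
      |G n ω - (G₁ ω + ∑ i ∈ Finset.range m, W i ω)| ≤ C * τ m ω) :
    TendstoInDistribution (fun (n : ℕ) ω => G n ω / √n) atTop (id : ℝ → ℝ) (fun _ => P)
      (gaussianReal 0 ((∫ ω, W 0 ω ^ 2 ∂P) / ∫ ω, τ 0 ω ∂P).toNNReal) := by
  set μ := ∫ ω, τ 0 ω ∂P with hμdef
  have hvar : Var[W 0; P] = ∫ ω, W 0 ω ^ 2 ∂P :=
    variance_of_integral_eq_zero (hWm 0).aemeasurable hW0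
  have hclt := tendstoInDistribution_inv_sqrt_mul_sum_sub
    (Y := (id : ℝ → ℝ)) (P' := gaussianReal 0 Var[W 0; P].toNNReal) ⟨by fun_prop, by simp⟩
    hWL2 hWind hWid
  simp only [hW0, mul_zero, sub_zero] at hclt
  have hN : Tendsto (fun n : ℕ => ⌊μ⁻¹ * n⌋₊) atTop atTop :=
    tendsto_nat_floor_atTop.comp (tendsto_natCast_atTop_atTop.const_mul_atTop (by positivity))
  have hsub : TendstoInDistribution (fun (n : ℕ) ω => (√(⌊μ⁻¹ * n⌋₊ : ℝ))⁻¹ *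
      ∑ k ∈ Finset.range ⌊μ⁻¹ * n⌋₊, W k ω) atTop (id : ℝ → ℝ) (fun _ => P)
      (gaussianReal 0 Var[W 0; P].toNNReal) :=
    { forall_aemeasurable := fun n => hclt.forall_aemeasurable _
      aemeasurable_limit := hclt.aemeasurable_limit
      tendsto := hclt.tendsto.comp hN }
  have hratio : Tendsto (fun n : ℕ => √((⌊μ⁻¹ * n⌋₊ : ℝ) / n)) atTop (𝓝 √(μ⁻¹)) :=
    ((tendsto_nat_floor_mul_div_atTop (by positivity)).comp
      tendsto_natCast_atTop_atTop).sqrt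
  have hscaled := hsub.continuous_comp_prodMk_of_tendstoInMeasure_const
    (g := fun x : ℝ × ℝ => x.1 * x.2) (by fun_prop)
    (Y := fun (n : ℕ) _ => √((⌊μ⁻¹ * n⌋₊ : ℝ) / n)) (c := √(μ⁻¹))
    (tendstoInMeasure_of_tendsto_ae (fun n => aestronglyMeasurable_const)
      (ae_of_all _ fun _ => hratio)) (fun n => aemeasurable_const)
  have hwalk : ∀ (n : ℕ) ω, (√(⌊μ⁻¹ * n⌋₊ : ℝ))⁻¹ *
      (∑ k ∈ Finset.range ⌊μ⁻¹ * n⌋₊, W k ω) * √((⌊μ⁻¹ * n⌋₊ : ℝ) / n) =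
      (∑ k ∈ Finset.range ⌊μ⁻¹ * n⌋₊, W k ω) / √n := by
    intro n ω
    rcases Nat.eq_zero_or_pos ⌊μ⁻¹ * n⌋₊ with h | h
    · simp [h]
    · have : √(⌊μ⁻¹ * n⌋₊ : ℝ) ≠ 0 := (Real.sqrt_pos.2 (by exact_mod_cast h)).ne'
      rw [Real.sqrt_div (Nat.cast_nonneg _), mul_comm (√(⌊μ⁻¹ * n⌋₊ : ℝ))⁻¹, mul_assoc,
        ← mul_div_assoc, inv_mul_cancel₀ this, mul_one_div]
  simp only [hwalk, id] at hscaled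
  have happrox := tendstoInMeasure_sub_sum_div_sqrt hτm hτ0 hτint hτ4 hτind hτid hμ hWm hWL2 hW0
    hWind hWid hT₁ hG₁ hC hG
  have hfinal := tendstoInDistribution_of_tendstoInMeasure_sub
    (fun (n : ℕ) ω => G n ω / √n) _ hscaled
    (happrox.congr (fun n => ae_of_all _ fun ω => by simp [sub_div, hμdef]) ae_eq_rfl)
    (fun n => ((hGm n).div_const _).aemeasurable)
  have hlaw : (gaussianReal 0 Var[W 0; P].toNNReal).map (fun x => x * √(μ⁻¹)) =
      gaussianReal 0 ((∫ ω, W 0 ω ^ 2 ∂P) / μ).toNNReal := by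
    rw [gaussianReal_map_mul_const, mul_zero]
    congr 1
    ext
    have h0 : 0 ≤ ∫ ω, W 0 ω ^ 2 ∂P := integral_nonneg fun ω => sq_nonneg _
    rw [hvar, Real.coe_toNNReal _ (by positivity), NNReal.coe_mul, Real.coe_toNNReal _ h0]
    change (√μ⁻¹) ^ 2 * _ = _
    rw [Real.sq_sqrt (by positivity)]
    field_simp
  refine ⟨hfinal.forall_aemeasurable, by fun_prop, ?_⟩
  convert hfinal.tendsto using 2
  refine congrArg _ (Subtype.ext ?_)
  exact Measure.map_id.trans hlaw.symm

end

end RenewalReward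

namespace VLMC

open ProbabilityTheory Topology

attribute [instance] VLMC.mΩ VLMC.hprob

/-! ### One-sided histories

A history lists the letters seen from the present backwards: `h 0` is the current letter. -/

/-- The history obtained from `h` by appending the letter `c`. -/
def hcons (c : Bool) (h : ℕ → Bool) : ℕ → Bool
  | 0 => c
  | i + 1 => h i

/-- The distance to the last letter `1`. -/
def lag (h : ℕ → Bool) : ℕ := sInf {i | h i = true}

/-- The `v - 1` letters to the left of the last letter `1`. -/
def word (v : ℕ) (h : ℕ → Bool) : Fin (v - 1) → Bool := fun j => h (lag h + (v - 1) - j)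

/-- The history ends with `v - 1` letters `0` followed by a letter `1`. -/
def Hit (v : ℕ) (h : ℕ → Bool) : Prop := h 0 = true ∧ ∀ i, 0 < i → i < v → h i = false

/-- Two histories agree up to (and including) the `v` letters ending at a letter `1`. -/
def Rel (v : ℕ) (h h' : ℕ → Bool) : Prop := ∃ i, h i = true ∧ ∀ j < i + v, h j = h' j

variable {v : ℕ} {p : ℕ → (Fin (v - 1) → Bool) → ℝ}

/-- The probability of appending the letter `c` to the history `h`. -/
def stepProb (p : ℕ → (Fin (v - 1) → Bool) → ℝ) (c : Bool) (h : ℕ → Bool) : ENNReal :=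
  ENNReal.ofReal (if c then p (lag h) (word v h) else 1 - p (lag h) (word v h))

open Classical in
/-- The probability that, starting from the history `h`, the first hit occurs after exactly `s`
steps, with `z` letters `1` appended up to that time. -/
def hitProb (p : ℕ → (Fin (v - 1) → Bool) → ℝ) : ℕ → ℤ → (ℕ → Bool) → ENNReal
  | 0, _, _ => 0
  | s + 1, z, h => ∑ c : Bool, stepProb p c h *
      if Hit v (hcons c h) then (if s = 0 ∧ z = c.toNat then 1 else 0)
      else hitProb p s (z - c.toNat) (hcons c h)

theorem Rel.hcons {h h' : ℕ → Bool} (hr : Rel v h h') (c : Bool) :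
    Rel v (hcons c h) (VLMC.hcons c h') := by
  obtain ⟨i, hi, hj⟩ := hr
  refine ⟨i + 1, hi, fun j hj' => ?_⟩
  cases j with
  | zero => rfl
  | succ j => exact hj j (by omega)

theorem lag_le {h : ℕ → Bool} {i : ℕ} (hi : h i = true) : lag h ≤ i := Nat.sInf_le hi

theorem lag_eq {h : ℕ → Bool} {i : ℕ} (hi : h i = true) (hlt : ∀ j < i, h j = false) :
    lag h = i := by
  refine le_antisymm (lag_le hi) (le_csInf ⟨i, hi⟩ fun j hj => ?_)
  by_contra hc
  have := hlt j (not_le.1 hc)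
  simp_all

theorem Rel.lag_eq (hv : 0 < v) {h h' : ℕ → Bool} (hr : Rel v h h') : lag h' = lag h := by
  obtain ⟨i, hi, hj⟩ := hr
  have hmem : h (lag h) = true := Nat.sInf_mem (s := {i | h i = true}) ⟨i, hi⟩
  have hle := lag_le hi
  refine VLMC.lag_eq (by rw [← hj _ (by omega), hmem]) fun j hjl => ?_
  rw [← hj _ (by omega)]
  by_contra hc
  exact absurd (lag_le (by simpa using hc)) (not_le.2 hjl)

theorem Rel.word_eq (hv : 0 < v) {h h' : ℕ → Bool} (hr : Rel v h h') : word v h' = word v h := by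
  have hl := hr.lag_eq hv
  obtain ⟨i, hi, hj⟩ := hr
  have hle := lag_le hi
  funext j
  simp only [word, hl]
  exact (hj _ (by omega)).symm

theorem Rel.hit_iff (hv : 0 < v) {h h' : ℕ → Bool} (hr : Rel v h h') : Hit v h' ↔ Hit v h := by
  obtain ⟨i, -, hj⟩ := hr
  unfold Hit
  rw [hj 0 (by omega)]
  refine and_congr_right fun _ => forall_congr' fun k => imp_congr_right fun _ =>
    imp_congr_right fun hk => ?_
  rw [hj k (by omega)]

theorem Rel.stepProb_eq (hv : 0 < v) {h h' : ℕ → Bool} (hr : Rel v h h') (c : Bool) :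
    stepProb p c h' = stepProb p c h := by
  simp only [stepProb, hr.lag_eq hv, hr.word_eq hv]

theorem Rel.hitProb_eq (hv : 0 < v) (s : ℕ) : ∀ (z : ℤ) {h h' : ℕ → Bool}, Rel v h h' →
    hitProb p s z h' = hitProb p s z h := by
  classical
  induction s with
  | zero => intros; rfl
  | succ s ih =>
    intro z h h' hr
    simp only [hitProb]
    refine Finset.sum_congr rfl fun c _ => ?_
    rw [hr.stepProb_eq hv, ih _ (hr.hcons c)]
    exact congrArg _ (if_congr ((hr.hcons c).hit_iff hv) rfl rfl)

theorem Hit.rel {h h' : ℕ → Bool} (hh : Hit v h) (hh' : Hit v h') : Rel v h h' := by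
  refine ⟨0, hh.1, fun j hj => ?_⟩
  rcases Nat.eq_zero_or_pos j with rfl | h0
  · rw [hh.1, hh'.1]
  · rw [hh.2 j h0 (by omega), hh'.2 j h0 (by omega)]

/-! ### Histories of the chain and cylinders -/

/-- The history of the chain at time `n`. -/
def hist (S : VLMC v p) (ω : S.Ω) (n : ℕ) : ℕ → Bool := fun i => S.cfg ω ((n : ℤ) - i)

/-- The letters appended up to time `t` are the same. -/
def Agree (S : VLMC v p) (t : ℕ) (ω ω' : S.Ω) : Prop :=
  ∀ i, 1 ≤ i → i ≤ t → S.X i ω = S.X i ω'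

/-- The event `A` is determined by the letters appended up to time `t`. -/
def Det (S : VLMC v p) (t : ℕ) (A : Set S.Ω) : Prop :=
  ∀ ω ω', S.Agree t ω ω' → ω ∈ A → ω' ∈ A

/-- The cylinder of the trajectories sharing with `ω` the letters up to time `t`. -/
def cyl (S : VLMC v p) (t : ℕ) (ω : S.Ω) : Set S.Ω := {ω' | S.Agree t ω ω'}

variable {S : VLMC v p}

theorem Agree.symm {t : ℕ} {ω ω' : S.Ω} (h : S.Agree t ω ω') : S.Agree t ω' ω :=
  fun i h1 h2 => (h i h1 h2).symm

theorem Agree.trans {t : ℕ} {ω ω' ω'' : S.Ω} (h : S.Agree t ω ω') (h' : S.Agree t ω' ω'') :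
    S.Agree t ω ω'' :=
  fun i h1 h2 => (h i h1 h2).trans (h' i h1 h2)

theorem Agree.mono {t s : ℕ} (hst : s ≤ t) {ω ω' : S.Ω} (h : S.Agree t ω ω') : S.Agree s ω ω' :=
  fun i h1 h2 => h i h1 (h2.trans hst)

theorem Agree.hist_eq {t : ℕ} {ω ω' : S.Ω} (h : S.Agree t ω ω') : S.hist ω t = S.hist ω' t := by
  funext i
  simp only [hist, S.hcfg]
  split_ifs with h0
  · rfl
  · exact h _ (by omega) (by omega)

theorem hist_succ (ω : S.Ω) (n : ℕ) : S.hist ω (n + 1) = hcons (S.X (n + 1) ω) (S.hist ω n) := by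
  funext i
  cases i with
  | zero =>
    simp only [hist, hcons, S.hcfg]
    rw [if_neg (by push_cast; omega)]
    congr 1
  | succ i =>
    simp only [hist, hcons]
    congr 1
    push_cast
    ring

theorem lag_hist (ω : S.Ω) (n : ℕ) : (lag (S.hist ω n) : ℤ) = n - S.mpos ω n := by
  obtain ⟨h1, h2, h3⟩ := S.hmpos ω n
  have : lag (S.hist ω n) = (n - S.mpos ω n).toNat := by
    refine lag_eq ?_ fun j hj => ?_
    · simp only [hist]
      rw [← h2]; congr 1; omega
    · exact h3 _ (by omega) (by omega)
  omega

theorem word_hist (ω : S.Ω) (n : ℕ) (j : Fin (v - 1)) :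
    word v (S.hist ω n) j = S.cfg ω (S.mpos ω n - ((v : ℤ) - 1) + (j.1 : ℤ)) := by
  have hl := lag_hist ω n
  have hj := j.2
  change S.cfg ω _ = _
  congr 1
  push_cast [show (j : ℕ) ≤ lag (S.hist ω n) + (v - 1) by omega, S.hv]
  omega

theorem hitY0_iff (ω : S.Ω) (n : ℕ) : S.hitY0 ω n ↔ Hit v (S.hist ω n) := by
  have hv := S.hv
  obtain ⟨h1, h2, h3⟩ := S.hmpos ω n
  unfold hitY0 Hit
  refine and_congr ?_ ?_
  · simp only [hist, Nat.cast_zero, sub_zero]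
    constructor
    · intro h; rwa [h] at h2
    · intro h
      by_contra hc
      have := h3 n (lt_of_le_of_ne h1 hc) le_rfl
      simp_all
  · simp only [hist]
    constructor
    · intro h i h0 hi
      have := h ⟨v - 1 - i, by omega⟩
      rw [← this]; congr 1; simp only; omega
    · intro h j
      have hj := j.2
      rw [← h (v - 1 - j) (by omega) (by omega)]; congr 1; omega

theorem Agree.hitY0_iff {t : ℕ} {ω ω' : S.Ω} (h : S.Agree t ω ω') :
    S.hitY0 ω t ↔ S.hitY0 ω' t := by
  rw [VLMC.hitY0_iff, VLMC.hitY0_iff, h.hist_eq]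

theorem Det.mono {t s : ℕ} (hst : s ≤ t) {A : Set S.Ω} (h : S.Det s A) : S.Det t A :=
  fun ω ω' hω => h ω ω' (hω.mono hst)

theorem Det.inter {t : ℕ} {A B : Set S.Ω} (h : S.Det t A) (h' : S.Det t B) : S.Det t (A ∩ B) :=
  fun ω ω' hω hm => ⟨h ω ω' hω hm.1, h' ω ω' hω hm.2⟩

theorem det_X (t : ℕ) (c : Bool) : S.Det (t + 1) {ω | S.X (t + 1) ω = c} :=
  fun _ _ h hm => (h (t + 1) (by omega) le_rfl).symm.trans hm

theorem measurable_letters (t : ℕ) : Measurable fun (ω : S.Ω) (i : Fin t) => S.X (i + 1) ω :=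
  measurable_pi_lambda _ fun _ => S.hXmeas _

theorem agree_iff_letters {t : ℕ} {ω ω' : S.Ω} : S.Agree t ω ω' ↔
    (fun i : Fin t => S.X (i + 1) ω) = fun i : Fin t => S.X (i + 1) ω' := by
  constructor
  · intro h; funext i; exact h _ (by omega) (by omega)
  · intro h i h1 h2
    have := congrFun h ⟨i - 1, by omega⟩
    simpa [Nat.sub_add_cancel h1] using this

theorem Det.measurableSet {t : ℕ} {A : Set S.Ω} (h : S.Det t A) : MeasurableSet A := by
  have : A = (fun (ω : S.Ω) (i : Fin t) => S.X (i + 1) ω) ⁻¹'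
      ((fun (ω : S.Ω) (i : Fin t) => S.X (i + 1) ω) '' A) := by
    refine (Set.subset_preimage_image _ _).antisymm ?_
    rintro ω ⟨ω', hω', he⟩
    exact h ω' ω (agree_iff_letters.2 he) hω'
  rw [this]
  exact measurable_letters t (Set.toFinite _).measurableSet

/-- Two measures which are comparable on cylinders are comparable on determined events. -/
theorem Det.measure_le {t : ℕ} {A : Set S.Ω} (h : S.Det t A) {μ ν : Measure S.Ω}
    (hle : ∀ ω ∈ A, μ (S.cyl t ω) ≤ ν (S.cyl t ω)) : μ A ≤ ν A := by
  classical
  have key : ∀ κ : Measure S.Ω, κ A = ∑ u : Fin t → Bool,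
      κ ((fun (ω : S.Ω) (i : Fin t) => S.X (i + 1) ω) ⁻¹' {u} ∩ A) := by
    intro κ
    have h1 := sum_measure_preimage_singleton (μ := κ.restrict A) Finset.univ
      (f := fun (ω : S.Ω) (i : Fin t) => S.X (i + 1) ω)
      fun u _ => measurable_letters t (measurableSet_singleton u)
    simp only [Finset.coe_univ, Set.preimage_univ, Measure.restrict_apply_univ] at h1
    rw [← h1]
    exact Finset.sum_congr rfl fun u _ =>
      Measure.restrict_apply (measurable_letters t (measurableSet_singleton u))
  rw [key μ, key ν]
  refine Finset.sum_le_sum fun u _ => ?_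
  rcases Set.eq_empty_or_nonempty
    ((fun (ω : S.Ω) (i : Fin t) => S.X (i + 1) ω) ⁻¹' {u} ∩ A) with he | ⟨ω, hu, hω⟩
  · simp [he]
  · have : (fun (ω : S.Ω) (i : Fin t) => S.X (i + 1) ω) ⁻¹' {u} ∩ A = S.cyl t ω := by
      ext ω'
      have hiff : ω' ∈ (fun (ω : S.Ω) (i : Fin t) => S.X (i + 1) ω) ⁻¹' {u} ↔
          S.Agree t ω ω' := by
        rw [agree_iff_letters, Set.mem_preimage, Set.mem_singleton_iff,
          show (fun i : Fin t => S.X (i + 1) ω) = u from hu, eq_comm]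
      constructor
      · exact fun hm => hiff.1 hm.1
      · exact fun hm => ⟨hiff.2 hm, h ω ω' hm hω⟩
    rw [this]
    exact hle ω hω

/-- The transition rule on cylinders. -/
theorem measure_cyl_inter (hp : ∀ k w, 0 ≤ p k w ∧ p k w ≤ 1) (t : ℕ) (ω : S.Ω) (c : Bool) :
    S.P (S.cyl t ω ∩ {ω' | S.X (t + 1) ω' = c}) =
      stepProb p c (S.hist ω t) * S.P (S.cyl t ω) := by
  have hset : {ω' : S.Ω | ∀ i : Fin t, S.X (i.1 + 1) ω' = S.X (i.1 + 1) ω} = S.cyl t ω := by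
    ext ω'
    change (∀ i : Fin t, S.X (i.1 + 1) ω' = S.X (i.1 + 1) ω) ↔ S.Agree t ω ω'
    rw [agree_iff_letters, funext_iff]
    exact forall_congr' fun i => eq_comm
  have htrue : S.P (S.cyl t ω ∩ {ω' | S.X (t + 1) ω' = true}) =
      ENNReal.ofReal (p (lag (S.hist ω t)) (word v (S.hist ω t))) * S.P (S.cyl t ω) := by
    have := S.htrans t (fun i => S.X (i.1 + 1) ω) (lag (S.hist ω t)) (word v (S.hist ω t)) ?_
    · rw [hset] at this
      rw [← this]
      congr 1
      rw [← hset]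
      rfl
    · intro ω' hω'
      have hag : S.Agree t ω ω' := by
        have : ω' ∈ S.cyl t ω := by rw [← hset]; exact hω'
        exact this
      rw [hag.hist_eq]
      exact ⟨(lag_hist ω' t).symm, fun j => (word_hist ω' t j).symm⟩
  cases c with
  | true => simpa [stepProb] using htrue
  | false =>
    have hsplit := measure_inter_add_sdiff (μ := S.P) (S.cyl t ω)
      (det_X (S := S) t true).measurableSet
    have hd : S.cyl t ω \ {ω' | S.X (t + 1) ω' = true} =
        S.cyl t ω ∩ {ω' | S.X (t + 1) ω' = false} := by
      ext ω'; simp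
    rw [hd, htrue] at hsplit
    obtain ⟨h0, h1⟩ := hp (lag (S.hist ω t)) (word v (S.hist ω t))
    have hfin : ENNReal.ofReal (p (lag (S.hist ω t)) (word v (S.hist ω t))) *
        S.P (S.cyl t ω) ≠ ⊤ := ENNReal.mul_ne_top ENNReal.ofReal_ne_top (measure_ne_top _ _)
    refine (ENNReal.add_right_inj hfin).1 (hsplit.trans ?_)
    simp only [stepProb, Bool.false_eq_true, if_false]
    rw [← add_mul, ← ENNReal.ofReal_add h0 (by linarith)]
    simp

/-- After time `t`, the first visit to `y₀` occurs at time `t + s`, and `z` letters `1` are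
appended during these `s` steps. -/
def firstHit (S : VLMC v p) (t s : ℕ) (z : ℤ) : Set S.Ω :=
  {ω | 0 < s ∧ S.hitY0 ω (t + s) ∧ (∀ n, t < n → n < t + s → ¬ S.hitY0 ω n) ∧
    ∑ n ∈ Finset.Ioc t (t + s), ((S.X n ω).toNat : ℤ) = z}

theorem det_firstHit (t s : ℕ) (z : ℤ) : S.Det (t + s) (S.firstHit t s z) := by
  rintro ω ω' h ⟨h0, h1, h2, h3⟩
  refine ⟨h0, h.hitY0_iff.1 h1, fun n hn hn' hc => h2 n hn hn' ?_, ?_⟩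
  · exact (h.mono hn'.le).hitY0_iff.2 hc
  · rw [← h3]
    refine Finset.sum_congr rfl fun n hn => ?_
    rw [Finset.mem_Ioc] at hn
    rw [h n (by omega) hn.2]

theorem measure_eq_sum_letter (t : ℕ) (B : Set S.Ω) :
    S.P B = ∑ c : Bool, S.P (B ∩ {ω | S.X t ω = c}) := by
  have hsplit := measure_inter_add_sdiff (μ := S.P) B
    (S.hXmeas t (measurableSet_singleton true))
  have hd : B \ (S.X t ⁻¹' {true}) = B ∩ {ω | S.X t ω = false} := by
    ext ω; simp
  rw [hd] at hsplit
  rw [Fintype.sum_bool, ← hsplit]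
  rfl

theorem cyl_inter_eq {t : ℕ} {ω ω' : S.Ω} {c : Bool}
    (h : ω' ∈ S.cyl t ω ∩ {ω | S.X (t + 1) ω = c}) :
    S.cyl t ω ∩ {ω | S.X (t + 1) ω = c} = S.cyl (t + 1) ω' := by
  obtain ⟨h1, h2⟩ := h
  ext ω''
  constructor
  · rintro ⟨h3, h4⟩ i hi hi'
    rcases Nat.lt_or_ge t i with hlt | hle
    · obtain rfl : i = t + 1 := by omega
      exact h2.trans (Eq.symm h4)
    · exact (h1.symm.trans h3) i hi hle
  · intro h3
    exact ⟨h1.trans (Agree.mono (Nat.le_succ t) h3), (h3 (t + 1) (by omega) le_rfl).symm.trans h2⟩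

/-- On a cylinder, the joint law of the waiting time for the next visit to `y₀` and of the number
of letters `1` appended in between depends only on the history. -/
theorem measure_cyl_inter_firstHit (hp : ∀ k w, 0 ≤ p k w ∧ p k w ≤ 1) (s : ℕ) :
    ∀ (t : ℕ) (z : ℤ) (ω : S.Ω), S.P (S.cyl t ω ∩ S.firstHit t s z) =
      S.P (S.cyl t ω) * hitProb p s z (S.hist ω t) := by
  classical
  induction s with
  | zero =>
    intro t z ω
    have : S.firstHit t 0 z = ∅ := by
      ext ω'
      simp [firstHit]
    simp [this, hitProb]
  | succ s ih =>
    intro t z ω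
    rw [measure_eq_sum_letter (t + 1), hitProb, Finset.mul_sum]
    refine Finset.sum_congr rfl fun c _ => ?_
    rw [Set.inter_right_comm, ← mul_assoc, mul_comm (S.P _), ← measure_cyl_inter hp]
    rcases Set.eq_empty_or_nonempty (S.cyl t ω ∩ {ω | S.X (t + 1) ω = c}) with he | ⟨ω₁, hω₁⟩
    · simp [he]
    rw [cyl_inter_eq hω₁]
    have hhist : hcons c (S.hist ω t) = S.hist ω₁ (t + 1) := by
      rw [hist_succ, hω₁.1.hist_eq, show S.X (t + 1) ω₁ = c from hω₁.2]
    have hX : ∀ ω' ∈ S.cyl (t + 1) ω₁, S.X (t + 1) ω' = c := fun ω' h =>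
      (h (t + 1) (by omega) le_rfl).symm.trans hω₁.2
    have hhit : ∀ ω' ∈ S.cyl (t + 1) ω₁, (S.hitY0 ω' (t + 1) ↔ Hit v (hcons c (S.hist ω t))) := by
      intro ω' h
      rw [hhist, ← VLMC.hitY0_iff]
      exact h.hitY0_iff.symm
    have hsum : ∀ ω' ∈ S.cyl (t + 1) ω₁, ∑ n ∈ Finset.Ioc t (t + (s + 1)),
        ((S.X n ω').toNat : ℤ) = c.toNat + ∑ n ∈ Finset.Ioc (t + 1) (t + 1 + s),
          ((S.X n ω').toNat : ℤ) := by
      intro ω' h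
      rw [← hX ω' h, show t + (s + 1) = t + 1 + s by ring,
        ← Finset.sum_Ioc_consecutive _ (Nat.le_succ t) (Nat.le_add_right _ _)]
      simp
    split_ifs with h1 h2
    · obtain ⟨rfl, rfl⟩ := h2
      rw [mul_one]
      congr 1
      refine Set.inter_eq_left.2 fun ω' h => ⟨by omega, (hhit ω' h).2 h1, by intros; omega, ?_⟩
      rw [hsum ω' h]
      simp
    · rw [mul_zero]
      convert measure_empty (μ := S.P)
      rw [Set.eq_empty_iff_forall_notMem]
      rintro ω' ⟨h, h3, h4, h5, h6⟩
      refine h2 ?_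
      have hs : s = 0 := by
        by_contra hs
        exact h5 (t + 1) (by omega) (by omega) ((hhit ω' h).2 h1)
      subst hs
      rw [hsum ω' h] at h6
      simp at h6
      exact ⟨rfl, h6.symm⟩
    · rw [hhist, ← ih]
      congr 1
      ext ω'
      refine and_congr_right fun h => ?_
      have h7 : ¬ S.hitY0 ω' (t + 1) := fun hc => h1 ((hhit ω' h).1 hc)
      have h8 := hsum ω' h
      rw [show t + (s + 1) = t + 1 + s by ring] at h8
      simp only [firstHit, Set.mem_ofPred_eq, show t + (s + 1) = t + 1 + s by ring]
      constructor
      · rintro ⟨-, h3, h4, h5⟩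
        refine ⟨?_, h3, fun n hn hn' => h4 n (by omega) hn', by omega⟩
        rcases Nat.eq_zero_or_pos s with rfl | hs
        · exact absurd h3 h7
        · exact hs
      · rintro ⟨h2, h3, h4, h5⟩
        refine ⟨by omega, h3, fun n hn hn' => ?_, by omega⟩
        rcases Nat.lt_or_ge (t + 1) n with hlt | hle
        · exact h4 n hlt hn'
        · obtain rfl : n = t + 1 := by omega
          exact h7

/-! ### Exponential tail of the waiting times -/

theorem Det.mul_measure_le_measure_inter {t : ℕ} {A : Set S.Ω} (h : S.Det t A)
    (hp : ∀ k w, 0 ≤ p k w ∧ p k w ≤ 1) {c : Bool} {δ : ENNReal}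
    (hδ : ∀ h : ℕ → Bool, δ ≤ stepProb p c h) :
    δ * S.P A ≤ S.P (A ∩ {ω | S.X (t + 1) ω = c}) := by
  have hm : MeasurableSet {ω | S.X (t + 1) ω = c} := (det_X (S := S) t c).measurableSet
  have := h.measure_le (μ := δ • S.P) (ν := S.P.restrict {ω | S.X (t + 1) ω = c}) fun ω _ => by
    rw [Measure.smul_apply, Measure.restrict_apply' hm, measure_cyl_inter hp, smul_eq_mul]
    gcongr
    exact hδ _
  rwa [Measure.smul_apply, Measure.restrict_apply' hm, smul_eq_mul] at this

/-- There is no visit to `y₀` during the time interval `(t, t + m]`. -/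
def noHit (S : VLMC v p) (t m : ℕ) : Set S.Ω := {ω | ∀ n, t < n → n ≤ t + m → ¬ S.hitY0 ω n}

theorem det_noHit (t m : ℕ) : S.Det (t + m) (S.noHit t m) :=
  fun _ _ h hm n hn hn' hc => hm n hn hn' ((h.mono hn').hitY0_iff.2 hc)

theorem hitY0_of_letters {t m : ℕ} {ω : S.Ω} (hm : m + 1 = v)
    (h0 : ∀ n, t < n → n ≤ t + m → S.X n ω = false) (h1 : S.X (t + m + 1) ω = true) :
    S.hitY0 ω (t + m + 1) := by
  rw [hitY0_iff]
  have hX : ∀ i, i < t + m + 1 → S.hist ω (t + m + 1) i = S.X (t + m + 1 - i) ω := by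
    intro i hi
    simp only [hist, S.hcfg]
    rw [if_neg (by push_cast; omega)]
    congr 1
    omega
  refine ⟨by rw [hX 0 (by omega)]; exact h1, fun i hi hi' => ?_⟩
  rw [hX i (by omega)]
  exact h0 _ (by omega) (by omega)

theorem Det.measure_inter_noHit_le_of_lt {t : ℕ} {A : Set S.Ω} (h : S.Det t A)
    (hp : ∀ k w, 0 ≤ p k w ∧ p k w ≤ 1) {δ : ENNReal}
    (hδ : ∀ (c : Bool) (h : ℕ → Bool), δ ≤ stepProb p c h) :
    S.P (A ∩ S.noHit t v) ≤ (1 - δ ^ v) * S.P A := by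
  obtain ⟨m, hm⟩ : ∃ m, m + 1 = v := ⟨v - 1, Nat.sub_add_cancel S.hv⟩
  have hzeros : ∀ j, S.Det (t + j) (A ∩ {ω | ∀ n, t < n → n ≤ t + j → S.X n ω = false}) ∧
      δ ^ j * S.P A ≤ S.P (A ∩ {ω | ∀ n, t < n → n ≤ t + j → S.X n ω = false}) := by
    intro j
    induction j with
    | zero =>
      have : A ∩ {ω | ∀ n, t < n → n ≤ t + 0 → S.X n ω = false} = A :=
        Set.inter_eq_left.2 fun ω _ n h1 h2 => by omega
      rw [this]
      exact ⟨h, by simp⟩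
    | succ j ih =>
      have hset : A ∩ {ω | ∀ n, t < n → n ≤ t + (j + 1) → S.X n ω = false} =
          A ∩ {ω | ∀ n, t < n → n ≤ t + j → S.X n ω = false} ∩
            {ω | S.X (t + j + 1) ω = false} := by
        ext ω
        constructor
        · rintro ⟨h1, h2⟩
          exact ⟨⟨h1, fun n hn hn' => h2 n hn (by omega)⟩, h2 _ (by omega) (by omega)⟩
        · rintro ⟨⟨h1, h2⟩, h3⟩
          refine ⟨h1, fun n hn hn' => ?_⟩
          rcases Nat.lt_or_ge (t + j) n with hlt | hle
          · obtain rfl : n = t + j + 1 := by omega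
            exact h3
          · exact h2 n hn hle
      rw [hset]
      refine ⟨(ih.1.mono (Nat.le_succ _)).inter (det_X _ _), ?_⟩
      refine le_trans ?_ (ih.1.mul_measure_le_measure_inter hp (hδ false))
      rw [pow_succ', mul_assoc]
      gcongr
      exact ih.2
  have hend : δ ^ v * S.P A ≤ S.P (A \ S.noHit t v) := by
    obtain ⟨h1, h2⟩ := hzeros m
    have h3 := h1.mul_measure_le_measure_inter hp (hδ true)
    calc δ ^ v * S.P A = δ * (δ ^ m * S.P A) := by
          rw [← mul_assoc, ← pow_succ', hm]
      _ ≤ _ := by gcongr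
      _ ≤ _ := h3
      _ ≤ S.P (A \ S.noHit t v) := by
        refine measure_mono ?_
        rintro ω ⟨⟨hA, hz⟩, ho⟩
        exact ⟨hA, fun hc => hc (t + m + 1) (by omega) (by omega) (hitY0_of_letters hm hz ho)⟩
  have hsplit := measure_inter_add_sdiff (μ := S.P) A (det_noHit (S := S) t v).measurableSet
  have hfin : S.P (A \ S.noHit t v) ≠ ⊤ := measure_ne_top _ _
  rw [ENNReal.sub_mul fun _ _ => measure_ne_top _ _, one_mul, ← hsplit]
  refine ENNReal.le_sub_of_add_le_right ?_ ?_
  · rw [hsplit]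
    exact ne_top_of_le_ne_top hfin hend
  · gcongr
    rw [hsplit]
    exact hend

theorem Det.measure_inter_noHit_le {t : ℕ} {A : Set S.Ω} (h : S.Det t A)
    (hp : ∀ k w, 0 ≤ p k w ∧ p k w ≤ 1) {δ : ENNReal}
    (hδ : ∀ (c : Bool) (h : ℕ → Bool), δ ≤ stepProb p c h) (m : ℕ) :
    S.P (A ∩ S.noHit t (m * v)) ≤ (1 - δ ^ v) ^ m * S.P A := by
  induction m with
  | zero =>
    rw [pow_zero, one_mul]
    exact measure_mono Set.inter_subset_left
  | succ m ih =>
    have hd : S.Det (t + m * v) (A ∩ S.noHit t (m * v)) :=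
      (h.mono (Nat.le_add_right _ _)).inter (det_noHit _ _)
    calc S.P (A ∩ S.noHit t ((m + 1) * v))
        ≤ S.P (A ∩ S.noHit t (m * v) ∩ S.noHit (t + m * v) v) := by
          refine measure_mono fun ω ⟨h1, h2⟩ => ⟨⟨h1, fun n hn hn' => h2 n hn ?_⟩,
            fun n hn hn' => h2 n ?_ ?_⟩
          · rw [Nat.succ_mul]; omega
          · omega
          · rw [Nat.succ_mul]; omega
      _ ≤ (1 - δ ^ v) * ((1 - δ ^ v) ^ m * S.P A) :=
          (hd.measure_inter_noHit_le_of_lt hp hδ).trans (by gcongr)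
      _ = _ := by rw [pow_succ', mul_assoc]

theorem ae_exists_hitY0 (hp : ∀ k w, 0 ≤ p k w ∧ p k w ≤ 1) {δ : ENNReal} (hδ0 : δ ≠ 0)
    (hδ : ∀ (c : Bool) (h : ℕ → Bool), δ ≤ stepProb p c h) :
    ∀ᵐ ω ∂S.P, ∀ t, ∃ n, t < n ∧ S.hitY0 ω n := by
  rw [ae_all_iff]
  intro t
  have hlt : 1 - δ ^ v < 1 :=
    ENNReal.sub_lt_self ENNReal.one_ne_top one_ne_zero (pow_ne_zero _ hδ0)
  have hlim := ENNReal.tendsto_pow_atTop_nhds_zero_of_lt_one hlt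
  refine le_antisymm (ge_of_tendsto' hlim fun m => ?_) zero_le
  have huniv : S.Det t (Set.univ : Set S.Ω) := fun _ _ _ _ => trivial
  have := huniv.measure_inter_noHit_le hp hδ m
  rw [measure_univ, mul_one, Set.univ_inter] at this
  refine (measure_mono ?_).trans this
  intro ω hω n hn hn' hc
  exact hω ⟨n, hn, hc⟩

/-! ### Regeneration times -/

/-- The `k`-th visit to `y₀` takes place, at time `t`. -/
def Visit (S : VLMC v p) : ℕ → ℕ → S.Ω → Prop
  | 0, t, _ => t = 0
  | k + 1, t, ω => ∃ s < t, Visit S k s ω ∧ S.hitY0 ω t ∧ ∀ n, s < n → n < t → ¬ S.hitY0 ω n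

theorem sInf_hitY0_eq {s t : ℕ} {ω : S.Ω} (hst : s < t) (ht : S.hitY0 ω t)
    (hno : ∀ n, s < n → n < t → ¬ S.hitY0 ω n) : sInf {n | s < n ∧ S.hitY0 ω n} = t := by
  refine le_antisymm (Nat.sInf_le ⟨hst, ht⟩) (le_csInf ⟨t, hst, ht⟩ fun n hn => ?_)
  by_contra hc
  exact hno n hn.1 (not_le.1 hc) hn.2

theorem Visit.T_eq {k : ℕ} : ∀ {t : ℕ} {ω : S.Ω}, S.Visit k t ω → S.T k ω = t := by
  induction k with
  | zero => intro t ω h; exact h.symm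
  | succ k ih =>
    rintro t ω ⟨s, hst, hs, ht, hno⟩
    rw [T, ih hs]
    exact sInf_hitY0_eq hst ht hno

theorem T_succ_spec {ω : S.Ω} (hω : ∀ t, ∃ n, t < n ∧ S.hitY0 ω n) (k : ℕ) :
    S.T k ω < S.T (k + 1) ω ∧ S.hitY0 ω (S.T (k + 1) ω) ∧
      ∀ n, S.T k ω < n → n < S.T (k + 1) ω → ¬ S.hitY0 ω n := by
  have hmem : sInf {n | S.T k ω < n ∧ S.hitY0 ω n} ∈ {n | S.T k ω < n ∧ S.hitY0 ω n} :=
    Nat.sInf_mem (hω _)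
  exact ⟨hmem.1, hmem.2, fun n hn hn' hc => Nat.notMem_of_lt_sInf hn' ⟨hn, hc⟩⟩

theorem visit_T {ω : S.Ω} (hω : ∀ t, ∃ n, t < n ∧ S.hitY0 ω n) (k : ℕ) :
    S.Visit k (S.T k ω) ω := by
  induction k with
  | zero => rfl
  | succ k ih =>
    obtain ⟨h1, h2, h3⟩ := T_succ_spec hω k
    exact ⟨_, h1, ih, h2, h3⟩

theorem Visit.of_agree {k : ℕ} : ∀ {t : ℕ} {ω ω' : S.Ω}, S.Agree t ω ω' → S.Visit k t ω →
    S.Visit k t ω' := by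
  induction k with
  | zero => intro t ω ω' _ h; exact h
  | succ k ih =>
    rintro t ω ω' h ⟨s, hst, hs, ht, hno⟩
    exact ⟨s, hst, ih (h.mono hst.le) hs, h.hitY0_iff.1 ht,
      fun n hn hn' hc => hno n hn hn' ((h.mono hn'.le).hitY0_iff.2 hc)⟩

theorem Visit.T_of_agree {k : ℕ} : ∀ {t : ℕ} {ω ω' : S.Ω}, S.Agree t ω ω' → S.Visit k t ω →
    ∀ j ≤ k, S.T j ω ≤ t ∧ S.T j ω' = S.T j ω := by
  induction k with
  | zero =>
    intro t ω ω' _ _ j hj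
    obtain rfl : j = 0 := by omega
    exact ⟨Nat.zero_le _, rfl⟩
  | succ k ih =>
    intro t ω ω' h hv j hj
    rcases Nat.lt_or_ge k j with hlt | hle
    · obtain rfl : j = k + 1 := by omega
      rw [hv.T_eq, (hv.of_agree h).T_eq]
      exact ⟨le_rfl, rfl⟩
    · obtain ⟨s, hst, hs, -⟩ := hv
      obtain ⟨h1, h2⟩ := ih (h.mono hst.le) hs j hle
      exact ⟨h1.trans hst.le, h2⟩

theorem Visit.hitY0 {k t : ℕ} {ω : S.Ω} (h : S.Visit (k + 1) t ω) : S.hitY0 ω t := by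
  obtain ⟨s, -, -, ht, -⟩ := h
  exact ht

theorem measurableSet_hitY0 (n : ℕ) : MeasurableSet {ω | S.hitY0 ω n} :=
  Det.measurableSet (t := n) fun _ _ h => h.hitY0_iff.1

theorem measurable_T (k : ℕ) : Measurable (S.T k) := by
  induction k with
  | zero => exact measurable_const
  | succ k ih =>
    have hset : ∀ n, MeasurableSet {ω | S.T k ω < n ∧ S.hitY0 ω n} := fun n =>
      (measurableSet_lt ih measurable_const).inter (measurableSet_hitY0 n)
    refine measurable_to_countable' fun t => ?_
    have : S.T (k + 1) ⁻¹' {t} =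
        ({ω | S.T k ω < t ∧ S.hitY0 ω t} ∩ ⋂ n < t, {ω | S.T k ω < n ∧ S.hitY0 ω n}ᶜ) ∪
          ({_ω | t = 0} ∩ ⋂ n, {ω | S.T k ω < n ∧ S.hitY0 ω n}ᶜ) := by
      ext ω
      simp only [Set.mem_preimage, Set.mem_singleton_iff, Set.mem_union, Set.mem_inter_iff,
        Set.mem_iInter, Set.mem_compl_iff, Set.mem_ofPred_eq]
      constructor
      · rintro rfl
        rcases Set.eq_empty_or_nonempty {n | S.T k ω < n ∧ S.hitY0 ω n} with he | hne
        · right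
          refine ⟨by rw [T, he, Nat.sInf_empty], fun n hn => ?_⟩
          have : n ∈ {n | S.T k ω < n ∧ S.hitY0 ω n} := hn
          rw [he] at this
          exact this
        · left
          exact ⟨Nat.sInf_mem hne, fun n hn => Nat.notMem_of_lt_sInf hn⟩
      · rintro (⟨⟨h1, h2⟩, h3⟩ | ⟨h1, h2⟩)
        · exact sInf_hitY0_eq h1 h2 fun n hn hn' hc => h3 n hn' ⟨hn, hc⟩
        · have : {n | S.T k ω < n ∧ S.hitY0 ω n} = ∅ :=
            Set.eq_empty_iff_forall_notMem.2 h2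
          rw [T, this, Nat.sInf_empty, h1]
    rw [this]
    exact ((hset t).inter (MeasurableSet.iInter fun n => MeasurableSet.iInter fun _ =>
      (hset n).compl)).union ((MeasurableSet.const _).inter
        (MeasurableSet.iInter fun n => (hset n).compl))

theorem measurable_R (n : ℕ) : Measurable (S.R n) :=
  Finset.measurable_fun_sum _ fun k _ => (measurable_of_finite Bool.toNat).comp (S.hXmeas k)

theorem R_add_sum_Ioc {m n : ℕ} (h : m ≤ n) (ω : S.Ω) :
    S.R m ω + ∑ k ∈ Finset.Ioc m n, (S.X k ω).toNat = S.R n ω :=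
  Finset.sum_Ioc_consecutive (fun k => (S.X k ω).toNat) (Nat.zero_le m) h

theorem measurable_tau (k : ℕ) : Measurable (S.tau k) := (measurable_T k).sub (measurable_T _)

theorem zeta_eq_sub (k : ℕ) (ω : S.Ω) : S.zeta k ω = S.R (S.T k ω) ω - S.R (S.T (k - 1) ω) ω := by
  rcases le_total (S.T (k - 1) ω) (S.T k ω) with h | h
  · have := R_add_sum_Ioc h ω
    rw [zeta]
    omega
  · have := R_add_sum_Ioc h ω
    rw [zeta, Finset.Ioc_eq_empty_of_le h, Finset.sum_empty]
    omega

theorem measurable_zeta (k : ℕ) : Measurable (S.zeta k) := by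
  have hR : Measurable fun x : ℕ × S.Ω => S.R x.1 x.2 :=
    measurable_from_prod_countable_right fun n => measurable_R n
  have : S.zeta k = fun ω => S.R (S.T k ω) ω - S.R (S.T (k - 1) ω) ω := funext (zeta_eq_sub k)
  rw [this]
  exact (hR.comp ((measurable_T k).prodMk measurable_id)).sub
    (hR.comp ((measurable_T (k - 1)).prodMk measurable_id))

/-- The regeneration vectors `ξ_k = (τ_k, ζ_k)`. -/
def xi (S : VLMC v p) (k : ℕ) (ω : S.Ω) : ℕ × ℕ := (S.tau k ω, S.zeta k ω)

theorem measurable_xi (k : ℕ) : Measurable (S.xi k) := (measurable_tau k).prodMk (measurable_zeta k)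

/-- The event `A` belongs to the past of the `k`-th visit to `y₀`. -/
def Past (S : VLMC v p) (k : ℕ) (A : Set S.Ω) : Prop :=
  ∀ t ω ω', S.Agree t ω ω' → S.Visit k t ω → ω ∈ A → ω' ∈ A

theorem past_univ (k : ℕ) : S.Past k Set.univ := fun _ _ _ _ _ _ => trivial

theorem past_xi {j k : ℕ} (hjk : j ≤ k) (B : Set (ℕ × ℕ)) : S.Past k (S.xi j ⁻¹' B) := by
  intro t ω ω' hω hv hm
  obtain ⟨h1, h2⟩ := Visit.T_of_agree hω hv j hjk
  obtain ⟨-, h3⟩ := Visit.T_of_agree hω hv (j - 1) (by omega)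
  have : S.xi j ω' = S.xi j ω := by
    simp only [xi, tau, zeta, h2, h3]
    congr 1
    refine Finset.sum_congr rfl fun n hn => ?_
    rw [Finset.mem_Ioc] at hn
    rw [hω n (by omega) (by omega)]
  rw [Set.mem_preimage, this]
  exact hm

theorem measure_eq_tsum_T (k : ℕ) (B : Set S.Ω) : S.P B = ∑' t, S.P (B ∩ {ω | S.T k ω = t}) := by
  have h1 := tsum_measure_preimage_singleton (μ := S.P.restrict B) Set.countable_univ
    (f := S.T k) fun t _ => measurable_T k (measurableSet_singleton t)
  rw [Set.preimage_univ, Measure.restrict_apply_univ,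
    tsum_univ fun t => S.P.restrict B (S.T k ⁻¹' {t})] at h1
  rw [← h1]
  refine tsum_congr fun t => ?_
  rw [Measure.restrict_apply (measurable_T k (measurableSet_singleton t)), Set.inter_comm]
  rfl

/-- The law of a regeneration vector. -/
def xiProb (p : ℕ → (Fin (v - 1) → Bool) → ℝ) (x : ℕ × ℕ) : ENNReal :=
  hitProb p x.1 x.2 (hcons true fun _ => false)

/-- **Regeneration**: the vector `ξ_{k+1}` is independent of the past of the `k`-th visit. -/
theorem Past.measure_inter_xi_eq {k : ℕ} {A : Set S.Ω} (hA : S.Past (k + 1) A)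
    (hp : ∀ k w, 0 ≤ p k w ∧ p k w ≤ 1) (hgood : ∀ᵐ ω ∂S.P, ∀ t, ∃ n, t < n ∧ S.hitY0 ω n)
    (x : ℕ × ℕ) : S.P (A ∩ S.xi (k + 2) ⁻¹' {x}) = S.P A * xiProb p x := by
  obtain ⟨s, z⟩ := x
  rw [measure_eq_tsum_T (k + 1), measure_eq_tsum_T (k + 1) A, ← ENNReal.tsum_mul_right]
  refine tsum_congr fun t => ?_
  set D : Set S.Ω := A ∩ {ω | S.Visit (k + 1) t ω} with hDdef
  have hD : S.Det t D := fun ω ω' hω hm => ⟨hA t ω ω' hω hm.2 hm.1, Visit.of_agree hω hm.2⟩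
  have h1 : S.P (A ∩ {ω | S.T (k + 1) ω = t}) = S.P D := by
    refine measure_congr ?_
    filter_upwards [hgood] with ω hω
    refine propext (and_congr_right fun _ => ⟨?_, fun h => h.T_eq⟩)
    rintro rfl
    exact visit_T hω (k + 1)
  have h2 : S.P (A ∩ S.xi (k + 2) ⁻¹' {(s, z)} ∩ {ω | S.T (k + 1) ω = t}) =
      S.P (D ∩ S.firstHit t s z) := by
    refine measure_congr ?_
    filter_upwards [hgood] with ω hω
    have hv := visit_T hω (k + 1)
    obtain ⟨h3, h4, h5⟩ := T_succ_spec hω (k + 1)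
    refine propext ⟨?_, ?_⟩
    · rintro ⟨⟨hωA, hx⟩, rfl⟩
      refine ⟨⟨hωA, hv⟩, ?_⟩
      obtain ⟨hx1, hx2⟩ := Prod.ext_iff.1 (show S.xi (k + 2) ω = (s, z) from hx)
      simp only [xi, tau, zeta, show k + 2 - 1 = k + 1 from rfl] at hx1 hx2
      have hs : S.T (k + 1) ω + s = S.T (k + 1 + 1) ω := by
        change S.T (k + 1 + 1) ω - S.T (k + 1) ω = s at hx1
        omega
      refine ⟨by omega, by rwa [hs], by rwa [hs], ?_⟩
      rw [hs, ← hx2]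
      push_cast
      rfl
    · rintro ⟨⟨hωA, hvt⟩, h6, h7, h8, h9⟩
      have ht := hvt.T_eq
      have hs : S.T (k + 2) ω = t + s := by
        rw [T, ht]
        exact sInf_hitY0_eq (by omega) h7 h8
      refine ⟨⟨hωA, Prod.ext ?_ ?_⟩, ht⟩
      · simp only [xi, tau, hs, show k + 2 - 1 = k + 1 from rfl, ht]
        omega
      · simp only [xi, zeta, hs, show k + 2 - 1 = k + 1 from rfl, ht]
        exact_mod_cast h9
  rw [h1, h2]
  have hmeas : MeasurableSet (S.firstHit t s z) := (det_firstHit t s z).measurableSet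
  have hcyl : ∀ ω ∈ D, S.P.restrict (S.firstHit t s z) (S.cyl t ω) =
      (xiProb p (s, z) • S.P) (S.cyl t ω) := by
    intro ω hω
    rw [Measure.restrict_apply' hmeas, measure_cyl_inter_firstHit hp, Measure.smul_apply,
      smul_eq_mul, mul_comm, xiProb]
    congr 1
    refine Rel.hitProb_eq S.hv s z (Hit.rel ?_ ((hitY0_iff ω t).1 hω.2.hitY0))
    refine ⟨rfl, fun i hi _ => ?_⟩
    cases i with
    | zero => omega
    | succ i => rfl
  rw [← Measure.restrict_apply' hmeas, mul_comm, ← smul_eq_mul, ← Measure.smul_apply]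
  exact le_antisymm (hD.measure_le fun ω hω => (hcyl ω hω).le)
    (hD.measure_le fun ω hω => (hcyl ω hω).ge)

theorem Past.measure_inter_xi_preimage {k : ℕ} {A : Set S.Ω} (hA : S.Past (k + 1) A)
    (hp : ∀ k w, 0 ≤ p k w ∧ p k w ≤ 1) (hgood : ∀ᵐ ω ∂S.P, ∀ t, ∃ n, t < n ∧ S.hitY0 ω n)
    (B : Set (ℕ × ℕ)) : S.P (A ∩ S.xi (k + 2) ⁻¹' B) = S.P A * S.P (S.xi 2 ⁻¹' B) := by
  have hmap : (S.P.restrict A).map (S.xi (k + 2)) = S.P A • S.P.map (S.xi 2) := by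
    refine Measure.ext_of_singleton fun x => ?_
    rw [Measure.map_apply (measurable_xi _) (measurableSet_singleton x),
      Measure.restrict_apply (measurable_xi _ (measurableSet_singleton x)), Set.inter_comm,
      hA.measure_inter_xi_eq hp hgood, Measure.smul_apply,
      Measure.map_apply (measurable_xi _) (measurableSet_singleton x), smul_eq_mul,
      ← Set.univ_inter (S.xi 2 ⁻¹' {x}), (past_univ 1).measure_inter_xi_eq hp hgood,
      measure_univ, one_mul]
  have hB : MeasurableSet B := B.to_countable.measurableSet
  have := congrArg (fun μ => μ B) hmap
  simp only [Measure.smul_apply, Measure.map_apply (measurable_xi _) hB, smul_eq_mul] at this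
  rwa [Measure.restrict_apply (measurable_xi _ hB), Set.inter_comm] at this

theorem measure_xi_preimage (hp : ∀ k w, 0 ≤ p k w ∧ p k w ≤ 1)
    (hgood : ∀ᵐ ω ∂S.P, ∀ t, ∃ n, t < n ∧ S.hitY0 ω n) (k : ℕ) (B : Set (ℕ × ℕ)) :
    S.P (S.xi (k + 2) ⁻¹' B) = S.P (S.xi 2 ⁻¹' B) := by
  have := (past_univ (S := S) (k + 1)).measure_inter_xi_preimage hp hgood B
  rwa [Set.univ_inter, measure_univ, one_mul] at this

theorem identDistrib_xi (hp : ∀ k w, 0 ≤ p k w ∧ p k w ≤ 1)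
    (hgood : ∀ᵐ ω ∂S.P, ∀ t, ∃ n, t < n ∧ S.hitY0 ω n) (k : ℕ) :
    IdentDistrib (S.xi (k + 2)) (S.xi 2) S.P S.P where
  aemeasurable_fst := (measurable_xi _).aemeasurable
  aemeasurable_snd := (measurable_xi _).aemeasurable
  map_eq := by
    ext B hB
    rw [Measure.map_apply (measurable_xi _) hB, Measure.map_apply (measurable_xi _) hB,
      measure_xi_preimage hp hgood]

theorem iIndepFun_xi (hp : ∀ k w, 0 ≤ p k w ∧ p k w ≤ 1)
    (hgood : ∀ᵐ ω ∂S.P, ∀ t, ∃ n, t < n ∧ S.hitY0 ω n) :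
    iIndepFun (fun k => S.xi (k + 2)) S.P := by
  classical
  have hprefix : ∀ (n : ℕ) (B : ℕ → Set (ℕ × ℕ)),
      S.Past (n + 1) (⋂ i ∈ Finset.range n, S.xi (i + 2) ⁻¹' B i) ∧
      S.P (⋂ i ∈ Finset.range n, S.xi (i + 2) ⁻¹' B i) =
        ∏ i ∈ Finset.range n, S.P (S.xi (i + 2) ⁻¹' B i) := by
    intro n B
    have hpast : ∀ n, S.Past (n + 1) (⋂ i ∈ Finset.range n, S.xi (i + 2) ⁻¹' B i) := by
      intro n t ω ω' hω hv hm
      simp only [Set.mem_iInter, Finset.mem_range] at hm ⊢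
      exact fun i hi => past_xi (by omega) (B i) t ω ω' hω hv (hm i hi)
    refine ⟨hpast n, ?_⟩
    induction n with
    | zero => simp
    | succ n ih =>
      rw [Finset.prod_range_succ, Finset.range_add_one, Finset.set_biInter_insert,
        Set.inter_comm, (hpast n).measure_inter_xi_preimage hp hgood, ih,
        measure_xi_preimage hp hgood n]
  rw [iIndepFun_iff_measure_inter_preimage_eq_mul]
  intro F B _
  obtain ⟨n, hn⟩ := F.exists_nat_subset_range
  have h := (hprefix n fun i => if i ∈ F then B i else Set.univ).2
  have h1 : ⋂ i ∈ Finset.range n, S.xi (i + 2) ⁻¹' (if i ∈ F then B i else Set.univ) =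
      ⋂ i ∈ F, S.xi (i + 2) ⁻¹' B i := by
    ext ω
    simp only [Set.mem_iInter, Set.mem_preimage]
    constructor
    · intro hm i hi
      simpa [hi] using hm i (hn hi)
    · intro hm i _
      split_ifs with hi
      · exact hm i hi
      · trivial
  have h2 : ∏ i ∈ Finset.range n, S.P (S.xi (i + 2) ⁻¹' (if i ∈ F then B i else Set.univ)) =
      ∏ i ∈ F, S.P (S.xi (i + 2) ⁻¹' B i) := by
    refine (Finset.prod_subset_one_on_sdiff hn (fun i hi => ?_) fun i hi => ?_).symm
    · simp [(Finset.mem_sdiff.1 hi).2]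
    · simp [hi]
  rw [h1, h2] at h
  exact h

/-! ### Moments of the regeneration vectors -/

theorem measure_lt_tau_two_le (hp : ∀ k w, 0 ≤ p k w ∧ p k w ≤ 1)
    (hgood : ∀ᵐ ω ∂S.P, ∀ t, ∃ n, t < n ∧ S.hitY0 ω n) {δ : ENNReal}
    (hδ : ∀ (c : Bool) (h : ℕ → Bool), δ ≤ stepProb p c h) (m : ℕ) :
    S.P {ω | m * v < S.tau 2 ω} ≤ (1 - δ ^ v) ^ m := by
  have hone : ∑' t, S.P {ω | S.T 1 ω = t} = 1 := by
    have := measure_eq_tsum_T (S := S) 1 Set.univ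
    simpa using this.symm
  rw [measure_eq_tsum_T 1]
  conv_rhs => rw [← mul_one ((1 - δ ^ v) ^ m)]
  conv_rhs => rhs; rw [← hone]
  rw [← ENNReal.tsum_mul_left]
  refine ENNReal.tsum_le_tsum fun t => ?_
  have hD : S.Det t {ω | S.Visit 1 t ω} := fun _ _ h hm => Visit.of_agree h hm
  calc S.P ({ω | m * v < S.tau 2 ω} ∩ {ω | S.T 1 ω = t})
      ≤ S.P ({ω | S.Visit 1 t ω} ∩ S.noHit t (m * v)) := by
        refine measure_mono_ae ?_
        filter_upwards [hgood] with ω hω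
        rintro ⟨h1, rfl⟩
        refine ⟨visit_T hω 1, fun n hn hn' => (T_succ_spec hω 1).2.2 n hn ?_⟩
        have h1' : m * v < S.T 2 ω - S.T 1 ω := h1
        change n < S.T 2 ω
        omega
    _ ≤ (1 - δ ^ v) ^ m * S.P {ω | S.Visit 1 t ω} := hD.measure_inter_noHit_le hp hδ m
    _ ≤ (1 - δ ^ v) ^ m * S.P {ω | S.T 1 ω = t} := by
        gcongr
        exact fun h => h.T_eq

theorem tsum_pow_mul_geometric_ne_top {ρ : ENNReal} (hρ : ρ < 1) (v k : ℕ) :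
    ∑' m : ℕ, (((m + 1) * v : ℕ) : ENNReal) ^ k * ρ ^ m ≠ ⊤ := by
  obtain ⟨r, hr1, hr2⟩ := ENNReal.lt_iff_exists_nnreal_btwn.1 hρ
  have hr0 : 0 < r := by
    have := (zero_le (a := ρ)).trans_lt hr1
    exact_mod_cast this
  have hr3 : r < 1 := by exact_mod_cast hr2
  have hs : Summable fun m : ℕ => (((m + 1) * v : ℕ) : NNReal) ^ k * r ^ m := by
    have h1 : Summable fun m : ℕ => ((m : ℝ) ^ k * (r : ℝ) ^ m) :=
      summable_pow_mul_geometric_of_norm_lt_one k (by simpa using hr3)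
    have h2 := ((summable_nat_add_iff 1).2 h1).mul_left ((v : ℝ) ^ k * (r : ℝ)⁻¹)
    rw [← NNReal.summable_coe]
    refine h2.congr fun m => ?_
    have : (r : ℝ) ≠ 0 := by exact_mod_cast hr0.ne'
    push_cast
    rw [mul_pow, pow_succ]
    field_simp
  refine ne_top_of_le_ne_top (ENNReal.tsum_coe_ne_top_iff_summable.2 hs) ?_
  refine ENNReal.tsum_le_tsum fun m => ?_
  push_cast
  gcongr

theorem lintegral_tau_pow_ne_top (hp : ∀ k w, 0 ≤ p k w ∧ p k w ≤ 1)
    (hgood : ∀ᵐ ω ∂S.P, ∀ t, ∃ n, t < n ∧ S.hitY0 ω n) {δ : ENNReal} (hδ0 : δ ≠ 0)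
    (hδ : ∀ (c : Bool) (h : ℕ → Bool), δ ≤ stepProb p c h) (k : ℕ) (hk : k ≠ 0) :
    ∫⁻ ω, (S.tau 2 ω : ENNReal) ^ k ∂S.P ≠ ⊤ := by
  have hv := S.hv
  have hm : ∀ m : ℕ, MeasurableSet {ω | m * v < S.tau 2 ω} := fun m =>
    measurableSet_lt measurable_const (measurable_tau 2)
  have hlt : 1 - δ ^ v < 1 :=
    ENNReal.sub_lt_self ENNReal.one_ne_top one_ne_zero (pow_ne_zero _ hδ0)
  refine ne_top_of_le_ne_top (tsum_pow_mul_geometric_ne_top hlt v k) ?_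
  calc ∫⁻ ω, (S.tau 2 ω : ENNReal) ^ k ∂S.P
      ≤ ∫⁻ ω, ∑' m : ℕ, {ω | m * v < S.tau 2 ω}.indicator
          (fun _ => (((m + 1) * v : ℕ) : ENNReal) ^ k) ω ∂S.P := by
        refine lintegral_mono fun ω => ?_
        rcases Nat.eq_zero_or_pos (S.tau 2 ω) with h0 | h0
        · simp [h0, hk]
        · refine le_trans ?_ (ENNReal.le_tsum ((S.tau 2 ω - 1) / v))
          rw [Set.indicator_of_mem]
          · gcongr
            have := Nat.lt_mul_div_succ (S.tau 2 ω - 1) hv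
            rw [mul_comm] at this
            omega
          · have := Nat.div_mul_le_self (S.tau 2 ω - 1) v
            change (S.tau 2 ω - 1) / v * v < S.tau 2 ω
            omega
    _ = ∑' m : ℕ, (((m + 1) * v : ℕ) : ENNReal) ^ k * S.P {ω | m * v < S.tau 2 ω} := by
        rw [lintegral_tsum fun m => (measurable_const.indicator (hm m)).aemeasurable]
        exact tsum_congr fun m => lintegral_indicator_const (hm m) _
    _ ≤ _ := by
        refine ENNReal.tsum_le_tsum fun m => ?_
        gcongr
        exact measure_lt_tau_two_le hp hgood hδ m

theorem integrable_tau_pow (hp : ∀ k w, 0 ≤ p k w ∧ p k w ≤ 1)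
    (hgood : ∀ᵐ ω ∂S.P, ∀ t, ∃ n, t < n ∧ S.hitY0 ω n) {δ : ENNReal} (hδ0 : δ ≠ 0)
    (hδ : ∀ (c : Bool) (h : ℕ → Bool), δ ≤ stepProb p c h) (k : ℕ) (hk : k ≠ 0) :
    Integrable (fun ω => (S.tau 2 ω : ℝ) ^ k) S.P := by
  refine ⟨((measurable_from_top.comp (measurable_tau 2)).pow_const k).aestronglyMeasurable, ?_⟩
  rw [hasFiniteIntegral_iff_enorm]
  refine lt_of_eq_of_lt ?_ (lintegral_tau_pow_ne_top hp hgood hδ0 hδ k hk).lt_top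
  refine lintegral_congr fun ω => ?_
  rw [enorm_pow, Real.enorm_natCast]

theorem R_le_add {m n : ℕ} (h : m ≤ n) (ω : S.Ω) :
    S.R m ω ≤ S.R n ω ∧ S.R n ω ≤ S.R m ω + (n - m) := by
  have h1 := R_add_sum_Ioc h ω
  have h2 : ∑ k ∈ Finset.Ioc m n, (S.X k ω).toNat ≤ n - m := by
    calc ∑ k ∈ Finset.Ioc m n, (S.X k ω).toNat ≤ ∑ k ∈ Finset.Ioc m n, 1 :=
          Finset.sum_le_sum fun k _ => Bool.toNat_le _
      _ = n - m := by simp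
  omega

theorem zeta_le_tau (k : ℕ) (ω : S.Ω) : S.zeta k ω ≤ S.tau k ω := by
  calc S.zeta k ω ≤ ∑ k ∈ Finset.Ioc (S.T (k - 1) ω) (S.T k ω), 1 :=
        Finset.sum_le_sum fun k _ => Bool.toNat_le _
    _ = S.tau k ω := by simp [tau]

theorem abs_zeta_sub_le (k : ℕ) (b : ℝ) (ω : S.Ω) :
    |(S.zeta k ω : ℝ) - b * S.tau k ω| ≤ (1 + |b|) * S.tau k ω := by
  have h1 : (S.zeta k ω : ℝ) ≤ S.tau k ω := by exact_mod_cast zeta_le_tau k ω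
  calc |(S.zeta k ω : ℝ) - b * S.tau k ω| ≤ |(S.zeta k ω : ℝ)| + |b * S.tau k ω| := abs_sub _ _
    _ = S.zeta k ω + |b| * S.tau k ω := by rw [abs_mul, Nat.abs_cast, Nat.abs_cast]
    _ ≤ _ := by linarith

/-! ### The renewal-reward structure of `R` -/

theorem T_one_add_sum_tau {ω : S.Ω} (hω : ∀ t, ∃ n, t < n ∧ S.hitY0 ω n) (m : ℕ) :
    (S.T 1 ω : ℝ) + ∑ i ∈ Finset.range m, (S.tau (i + 2) ω : ℝ) = S.T (m + 1) ω := by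
  induction m with
  | zero => simp
  | succ m ih =>
    rw [Finset.sum_range_succ, ← add_assoc, ih]
    have h : S.T (m + 1) ω ≤ S.T (m + 1 + 1) ω := (T_succ_spec hω (m + 1)).1.le
    rw [tau, show m + 2 - 1 = m + 1 from rfl, Nat.cast_sub h]
    ring

theorem R_T_one_add_sum {ω : S.Ω} (hω : ∀ t, ∃ n, t < n ∧ S.hitY0 ω n) (b : ℝ) (m : ℕ) :
    (S.R (S.T 1 ω) ω - b * S.T 1 ω : ℝ) +
        ∑ i ∈ Finset.range m, ((S.zeta (i + 2) ω : ℝ) - b * S.tau (i + 2) ω) =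
      S.R (S.T (m + 1) ω) ω - b * S.T (m + 1) ω := by
  induction m with
  | zero => simp
  | succ m ih =>
    rw [Finset.sum_range_succ, ← add_assoc, ih]
    have h : S.T (m + 1) ω ≤ S.T (m + 1 + 1) ω := (T_succ_spec hω (m + 1)).1.le
    rw [tau, zeta_eq_sub, show m + 2 - 1 = m + 1 from rfl, Nat.cast_sub h,
      Nat.cast_sub (R_le_add h ω).1]
    ring

theorem abs_R_sub_le {ω : S.Ω} (b : ℝ) {n m : ℕ}
    (h1 : S.T (m + 1) ω ≤ n) (h2 : n < S.T (m + 2) ω) :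
    |((S.R n ω : ℝ) - b * n) - (S.R (S.T (m + 1) ω) ω - b * S.T (m + 1) ω)| ≤
      (1 + |b|) * S.tau (m + 2) ω := by
  obtain ⟨h3, h4⟩ := R_le_add h1 ω
  have h3' : (S.R (S.T (m + 1) ω) ω : ℝ) ≤ S.R n ω := by exact_mod_cast h3
  have h1' : (S.T (m + 1) ω : ℝ) ≤ n := by exact_mod_cast h1
  have h4' : (S.R n ω : ℝ) ≤ S.R (S.T (m + 1) ω) ω + (n - S.T (m + 1) ω) := by
    rw [← Nat.cast_sub h1]
    exact_mod_cast h4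
  have h5 : (n : ℝ) - S.T (m + 1) ω ≤ S.tau (m + 2) ω := by
    rw [← Nat.cast_sub h1]
    have : n - S.T (m + 1) ω ≤ S.T (m + 2) ω - S.T (m + 1) ω := by omega
    exact_mod_cast this
  calc |((S.R n ω : ℝ) - b * n) - (S.R (S.T (m + 1) ω) ω - b * S.T (m + 1) ω)|
      = |((S.R n ω : ℝ) - S.R (S.T (m + 1) ω) ω) - b * (n - S.T (m + 1) ω)| := by
        congr 1; ring
    _ ≤ |(S.R n ω : ℝ) - S.R (S.T (m + 1) ω) ω| + |b * (n - S.T (m + 1) ω)| := abs_sub _ _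
    _ = (S.R n ω - S.R (S.T (m + 1) ω) ω) + |b| * (n - S.T (m + 1) ω) := by
        rw [abs_mul, abs_of_nonneg (sub_nonneg.2 h3'), abs_of_nonneg (sub_nonneg.2 h1')]
    _ ≤ (n - S.T (m + 1) ω) + |b| * (n - S.T (m + 1) ω) := by linarith
    _ = (1 + |b|) * (n - S.T (m + 1) ω) := by ring
    _ ≤ _ := by gcongr

theorem CondA.le_stepProb {δ1 δ2 : ℝ} (hA : S.CondA δ1 δ2) (c : Bool) (h : ℕ → Bool) :
    ENNReal.ofReal (min δ2 (1 - δ1)) ≤ stepProb p c h := by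
  obtain ⟨-, -, -, -, hp⟩ := hA
  refine ENNReal.ofReal_le_ofReal ?_
  obtain ⟨h1, h2⟩ := hp (lag h) (word v h)
  split_ifs
  · exact (min_le_left _ _).trans h1
  · exact (min_le_right _ _).trans (by linarith)

theorem tendstoInDistribution_R {δ1 δ2 : ℝ} (hA : S.CondA δ1 δ2) :
    TendstoInDistribution (fun (n : ℕ) ω => ((S.R n ω : ℝ) - S.a * n) / √n) atTop (id : ℝ → ℝ)
      (fun _ => S.P) (gaussianReal 0 S.sigma2.toNNReal) := by
  have hp : ∀ k w, 0 ≤ p k w ∧ p k w ≤ 1 := fun k w =>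
    ⟨hA.2.1.le.trans (hA.2.2.2.2 k w).1, (hA.2.2.2.2 k w).2.trans hA.2.2.2.1.le⟩
  have hδ0 : ENNReal.ofReal (min δ2 (1 - δ1)) ≠ 0 := by
    have := hA.2.1
    have := hA.2.2.2.1
    exact (ENNReal.ofReal_pos.2 (lt_min hA.2.1 (by linarith))).ne'
  have hδ := hA.le_stepProb
  have hgood := ae_exists_hitY0 (S := S) hp hδ0 hδ
  have hind := iIndepFun_xi hp hgood
  have hid := identDistrib_xi hp hgood
  have hpow := fun k hk => integrable_tau_pow hp hgood hδ0 hδ k hk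
  have hτint : Integrable (fun ω => (S.tau 2 ω : ℝ)) S.P := by simpa using hpow 1 one_ne_zero
  have hcast : ∀ {f : S.Ω → ℕ}, Measurable f → Measurable fun ω => (f ω : ℝ) := fun hf =>
    measurable_from_top.comp hf
  have hζint : Integrable (fun ω => (S.zeta 2 ω : ℝ)) S.P := by
    refine hτint.mono' (hcast (measurable_zeta 2)).aestronglyMeasurable (ae_of_all _ fun ω => ?_)
    rw [Real.norm_natCast]
    exact_mod_cast zeta_le_tau 2 ω
  have hμ : 0 < ∫ ω, (S.tau 2 ω : ℝ) ∂S.P := by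
    refine zero_lt_one.trans_le ?_
    calc (1 : ℝ) = ∫ _, (1 : ℝ) ∂S.P := by simp
      _ ≤ _ := by
        refine integral_mono_ae (integrable_const _) hτint ?_
        filter_upwards [hgood] with ω hω
        have h : S.T 1 ω < S.T 2 ω := (T_succ_spec hω 1).1
        have : 1 ≤ S.T 2 ω - S.T 1 ω := by omega
        change (1 : ℝ) ≤ S.tau 2 ω
        exact_mod_cast this
  have hWm : ∀ k, Measurable fun ω => (S.zeta k ω : ℝ) - S.a * S.tau k ω := fun k =>
    (hcast (measurable_zeta k)).sub ((hcast (measurable_tau k)).const_mul _)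
  have hτfun : Measurable fun x : ℕ × ℕ => (x.1 : ℝ) := measurable_of_countable _
  have hWfun : Measurable fun x : ℕ × ℕ => (x.2 : ℝ) - S.a * x.1 := measurable_of_countable _
  refine tendstoInDistribution_renewalReward_div_sqrt
    (τ := fun i ω => (S.tau (i + 2) ω : ℝ))
    (W := fun i ω => (S.zeta (i + 2) ω : ℝ) - S.a * S.tau (i + 2) ω)
    (G := fun n ω => (S.R n ω : ℝ) - S.a * n)
    (T₁ := fun ω => (S.T 1 ω : ℝ)) (G₁ := fun ω => (S.R (S.T 1 ω) ω : ℝ) - S.a * S.T 1 ω)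
    (C := 1 + |S.a|) (fun i => hcast (measurable_tau _)) (fun i ω => Nat.cast_nonneg _) hτint
    (hpow 4 (by norm_num)) (hind.comp (fun _ x => (x.1 : ℝ)) fun _ => hτfun)
    (fun i => (hid i).comp hτfun) hμ (fun i => hWm _) ?_ ?_
    (hind.comp (fun _ x => (x.2 : ℝ) - S.a * x.1) fun _ => hWfun) (fun i => (hid i).comp hWfun)
    (hcast (measurable_T 1)) ?_ (by positivity)
    (fun n => (hcast (measurable_R n)).sub_const _) ?_
  · rw [memLp_two_iff_integrable_sq (hWm 2).aestronglyMeasurable]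
    refine ((hpow 2 two_ne_zero).const_mul ((1 + |S.a|) ^ 2)).mono'
      ((hWm 2).pow_const 2).aestronglyMeasurable (ae_of_all _ fun ω => ?_)
    rw [norm_pow, Real.norm_eq_abs, ← mul_pow]
    gcongr
    exact abs_zeta_sub_le 2 _ ω
  · rw [integral_sub hζint (hτint.const_mul _), integral_const_mul]
    change _ - S.a * _ = 0
    rw [a, div_mul_cancel₀ _ hμ.ne', sub_self]
  · have hR : Measurable fun x : ℕ × S.Ω => S.R x.1 x.2 :=
      measurable_from_prod_countable_right fun n => measurable_R n
    exact (hcast (hR.comp ((measurable_T 1).prodMk measurable_id))).sub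
      ((hcast (measurable_T 1)).const_mul _)
  · filter_upwards [hgood] with ω hω n m h1 h2
    rw [T_one_add_sum_tau hω] at h1 h2
    rw [R_T_one_add_sum hω]
    exact abs_R_sub_le _ (by exact_mod_cast h1) (by exact_mod_cast h2)

end VLMC

namespace VLMC

/-- Theorem 1.5(2): under condition [A], the central limit theorem
holds: `(R(n) - a n)/√n` converges in distribution to the normal law `N(0, σ²)`
(convergence in distribution is expressed by testing against all bounded continuous
functions). -/
theorem statement1 {v : ℕ} {p : ℕ → (Fin (v - 1) → Bool) → ℝ} (S : VLMC v p)
    (hA : ∃ δ1 δ2 : ℝ, S.CondA δ1 δ2) :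
    ∀ f : BoundedContinuousFunction ℝ ℝ,
      Filter.Tendsto
        (fun n : ℕ => ∫ ω, f (((S.R n ω : ℝ) - S.a * n) / Real.sqrt n) ∂S.P)
        Filter.atTop
        (nhds (∫ x, f x ∂(ProbabilityTheory.gaussianReal 0 S.sigma2.toNNReal))) := by
  intro f
  obtain ⟨δ1, δ2, hA⟩ := hA
  have h := tendstoInDistribution_R hA
  have hlim := ProbabilityMeasure.tendsto_iff_forall_integral_tendsto.1 h.tendsto f
  have hf : ∀ μ : Measure ℝ, AEStronglyMeasurable f μ := fun μ =>
    f.continuous.aestronglyMeasurable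
  simp only [ProbabilityMeasure.coe_mk, Measure.map_id] at hlim
  refine hlim.congr fun n => ?_
  exact integral_map (h.forall_aemeasurable n) (hf _)

end VLMC
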